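/- Let G=(V,A) and G'=(V,A') be two (≤6)-hemimorphic digraphs, let C∈D_{G,G'} be a difference class, and let I0⊆V be such that G[I0] is a peak or a flag and G'[I0]≅G[I0]. Then: (1) C is an interval of both G and G', and no flag embeds into G[C]; (2) for every J0⊆V such that G[J0] is a flag, G'[J0]≅G[J0]; (3) if J0⊆V is such that G[J0] is a flag and C∩J0≠∅, then G[C] and G'[C] are (≤4)-hypomorphic. -/

import Mathlib

universe u v

/-- A digraph: an irreflexive binary relation on a vertex type. -/
structure Dgraph (V : Type u) where
  Arc : V → V → Prop
  irrefl : ∀ x, ¬ Arc x x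

namespace Dgraph

variable {V : Type u} {W : Type v}

/-- The dual digraph. -/
def dual (G : Dgraph V) : Dgraph V :=
  ⟨fun x y => G.Arc y x, fun x h => G.irrefl x h⟩

/-- Subdigraph induced by a set of vertices. -/
def ind (G : Dgraph V) (X : Set V) : Dgraph X :=
  ⟨fun x y => G.Arc x y, fun x h => G.irrefl x h⟩

/-- Isomorphism of digraphs. -/
def Iso (G : Dgraph V) (G' : Dgraph W) : Prop :=
  ∃ e : V ≃ W, ∀ x y, G.Arc x y ↔ G'.Arc (e x) (e y)

/-- `G` and `G'` are hemimorphic: `G'` is isomorphic to `G` or to its dual. -/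
def Hemi (G : Dgraph V) (G' : Dgraph W) : Prop :=
  Iso G G' ∨ Iso G.dual G'

/-- Self-dual digraph. -/
def SelfDual (G : Dgraph V) : Prop := Iso G G.dual

/-- `{x,y}` is a directed pair. -/
def Dir (G : Dgraph V) (x y : V) : Prop :=
  (G.Arc x y ∧ ¬ G.Arc y x) ∨ (G.Arc y x ∧ ¬ G.Arc x y)

/-- `{x,y}` is a neutral pair (full or void). -/
def Neutral (G : Dgraph V) (x y : V) : Prop :=
  x ≠ y ∧ ¬ G.Dir x y

/-- Interval of a digraph. -/
def IsInterval (G : Dgraph V) (I : Set V) : Prop :=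
  ∀ x ∉ I,
    (∀ y ∈ I, G.Arc x y ∧ ¬ G.Arc y x) ∨ (∀ y ∈ I, G.Arc y x ∧ ¬ G.Arc x y) ∨
    (∀ y ∈ I, G.Arc x y ∧ G.Arc y x) ∨ (∀ y ∈ I, ¬ G.Arc x y ∧ ¬ G.Arc y x)

/-- The arc-connectivity equivalence relation. -/
def ACRel (G : Dgraph V) : V → V → Prop := Relation.ReflTransGen G.Dir

/-- Arc-connected components. -/
def IsACComponent (G : Dgraph V) (D : Set V) : Prop :=
  ∃ x, D = {y | G.ACRel x y}

/-- Arc-connected digraph (at most one arc-connected component). -/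
def ArcConnected (G : Dgraph V) : Prop := ∀ x y, G.ACRel x y

/-- Tournament. -/
def IsTournament (G : Dgraph V) : Prop := ∀ x y, x ≠ y → G.Dir x y

/-- Chain (transitive tournament). -/
def IsChainD (G : Dgraph V) : Prop :=
  G.IsTournament ∧ ∀ x y z, G.Arc x y → G.Arc y z → G.Arc x z

/-- Dgraph from a relation, with forced irreflexivity. -/
def ofRel (r : V → V → Prop) : Dgraph V := ⟨fun x y => x ≠ y ∧ r x y, fun x h => h.1 rfl⟩

/-- The model flag. -/
def flagD : Dgraph (Fin 3) :=
  ofRel (fun x y => (x = 0 ∧ y = 1) ∨ (x = 1 ∧ y = 2) ∨ (x = 2 ∧ y = 1))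

/-- First model peak. -/
def peakD1 : Dgraph (Fin 3) :=
  ofRel (fun x y => (x = 0 ∧ y = 1) ∨ (x = 0 ∧ y = 2) ∨ (x = 1 ∧ y = 2) ∨ (x = 2 ∧ y = 1))

/-- Second model peak. -/
def peakD2 : Dgraph (Fin 3) :=
  ofRel (fun x y => (x = 0 ∧ y = 1) ∨ (x = 0 ∧ y = 2))

/-- The model diamond. -/
def diamondD : Dgraph (Fin 4) :=
  ofRel (fun x y => (x = 0 ∧ y = 1) ∨ (x = 0 ∧ y = 2) ∨ (x = 0 ∧ y = 3) ∨
    (x = 1 ∧ y = 2) ∨ (x = 2 ∧ y = 3) ∨ (x = 3 ∧ y = 1))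

/-- A flag is a digraph hemimorphic to the model flag. -/
def IsFlag (G : Dgraph V) : Prop := Hemi G flagD

/-- A peak is a digraph hemimorphic to one of the two model peaks. -/
def IsPeak (G : Dgraph V) : Prop := Hemi G peakD1 ∨ Hemi G peakD2

/-- A diamond is a digraph hemimorphic to the model diamond. -/
def IsDiamond (G : Dgraph V) : Prop := Hemi G diamondD

/-- Prechain: embeds no peak, no diamond, no two adjacent neutral pairs. -/
def IsPrechain (G : Dgraph V) : Prop :=
  (∀ X : Set V, ¬ IsPeak (G.ind X)) ∧ (∀ X : Set V, ¬ IsDiamond (G.ind X)) ∧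
  ¬ ∃ x y z : V, y ≠ z ∧ G.Neutral x y ∧ G.Neutral x z

/-- Proper prechain: a prechain which is not a chain. -/
def ProperPrechain (G : Dgraph V) : Prop := G.IsPrechain ∧ ¬ G.IsChainD

/-- Diamond-free tournament. -/
def DiamondFreeTournament (G : Dgraph V) : Prop :=
  G.IsTournament ∧ ∀ X : Set V, ¬ IsDiamond (G.ind X)

/-- Non-tournament prechain. -/
def NonTournamentPrechain (G : Dgraph V) : Prop := G.IsPrechain ∧ ¬ G.IsTournament

/-- Model finite consecutivity on `n` vertices (`full` decides whether the
non-consecutive pairs are all full or all void). -/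
def consecFin (n : ℕ) (full : Bool) : Dgraph (Fin n) :=
  ofRel (fun i j => i.1 + 1 = j.1 ∨ (full = true ∧ (i.1 + 1 < j.1 ∨ j.1 + 1 < i.1)))

/-- Model consecutivity of type ω. -/
def consecNat (full : Bool) : Dgraph ℕ :=
  ofRel (fun i j => i + 1 = j ∨ (full = true ∧ (i + 1 < j ∨ j + 1 < i)))

/-- Model consecutivity of type ω*+ω. -/
def consecInt (full : Bool) : Dgraph ℤ :=
  ofRel (fun i j => i + 1 = j ∨ (full = true ∧ (i + 1 < j ∨ j + 1 < i)))

/-- One-end infinite consecutivity (obtained from ω or ω*). -/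
def OneEndInfiniteConsecutivity (G : Dgraph V) : Prop :=
  ∃ full, Iso G (consecNat full) ∨ Iso G (consecNat full).dual

/-- Consecutivity. -/
def IsConsecutivity (G : Dgraph V) : Prop :=
  (∃ n, 3 ≤ n ∧ ∃ full, Iso G (consecFin n full)) ∨
  G.OneEndInfiniteConsecutivity ∨ (∃ full, Iso G (consecInt full))

/-- Model cycle on `n ≥ 3` vertices obtained from the finite consecutivity by
replacing the neutral pair `{0, n-1}` by the arc `(n-1, 0)`. -/
def cycleD (n : ℕ) (full : Bool) : Dgraph (Fin n) :=
  ofRel (fun i j => i.1 + 1 = j.1 ∨ (i.1 = n - 1 ∧ j.1 = 0) ∨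
    (full = true ∧ (i.1 + 1 < j.1 ∨ j.1 + 1 < i.1) ∧
      ¬ (i.1 = 0 ∧ j.1 = n - 1) ∧ ¬ (i.1 = n - 1 ∧ j.1 = 0)))

/-- Cycle. -/
def IsCycle (G : Dgraph V) : Prop := ∃ n, 3 ≤ n ∧ ∃ full, Iso G (cycleD n full)

/-- Near-chain: obtained from a chain by exchanging the directed pair formed
by its extremities. -/
def IsNearChain (G : Dgraph V) : Prop :=
  ∃ (H : Dgraph V) (m M : V), H.IsChainD ∧ m ≠ M ∧
    (∀ x, x ≠ m → H.Arc m x) ∧ (∀ x, x ≠ M → H.Arc x M) ∧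
    (∀ x y, G.Arc x y ↔ ((H.Arc x y ∧ ¬ (x = m ∧ y = M)) ∨ (x = M ∧ y = m)))

/-- `{k}`-hypomorphy. -/
def KHypo (k : ℕ) (G G' : Dgraph V) : Prop :=
  ∀ X : Set V, X.Finite → X.ncard = k → Iso (G.ind X) (G'.ind X)

/-- `(≤ k)`-hypomorphy. -/
def LeHypo (k : ℕ) (G G' : Dgraph V) : Prop :=
  ∀ j, 1 ≤ j → j ≤ k → KHypo j G G'

/-- `{k}`-hemimorphy. -/
def KHemi (k : ℕ) (G G' : Dgraph V) : Prop :=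
  ∀ X : Set V, X.Finite → X.ncard = k → Hemi (G.ind X) (G'.ind X)

/-- `(≤ k)`-hemimorphy. -/
def LeHemi (k : ℕ) (G G' : Dgraph V) : Prop :=
  ∀ j, 1 ≤ j → j ≤ k → KHemi j G G'

/-- `(≤ k)`-half-reconstructibility. -/
def HalfRecon (k : ℕ) (G : Dgraph V) : Prop :=
  ∀ G' : Dgraph V, LeHemi k G G' → Hemi G G'

/-- One step of the difference relation. -/
def DiffStep (G G' : Dgraph V) (x y : V) : Prop := G.Arc x y ↔ ¬ G'.Arc x y

/-- The difference relation `𝔇_{G,G'}`. -/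
def DiffRel (G G' : Dgraph V) (x y : V) : Prop :=
  x = y ∨ Relation.TransGen (DiffStep G G') x y

/-- Difference classes: `C ∈ D_{G,G'}`. -/
def DiffClass (G G' : Dgraph V) (C : Set V) : Prop :=
  ∃ x, C = {y | DiffRel G G' x y}

/-- The difference relation has at least two equivalence classes. -/
def AtLeastTwoDiffClasses (G G' : Dgraph V) : Prop :=
  ∃ C₁ C₂ : Set V, DiffClass G G' C₁ ∧ DiffClass G G' C₂ ∧ C₁ ≠ C₂

/-- `C_dual(G)`: the smallest cardinality of a finite set of vertices inducing a
non-self-dual subdigraph (`⊤` if there is none). -/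
noncomputable def Cdual (G : Dgraph V) : ℕ∞ :=
  sInf {n : ℕ∞ | ∃ X : Set V, X.Finite ∧ ¬ SelfDual (G.ind X) ∧ n = (X.ncard : ℕ∞)}

/-- The contracted digraph `G_I` (the vertex `none` plays the role of `I`). -/
def contract (G : Dgraph V) (I : Set V) : Dgraph (Option {x : V // x ∉ I}) where
  Arc := fun a b =>
    match a, b with
    | some x, some y => G.Arc x.1 y.1
    | some x, none => ∃ z ∈ I, G.Arc x.1 z
    | none, some y => ∃ z ∈ I, G.Arc z y.1
    | none, none => False
  irrefl := by
    rintro (_ | ⟨x, hx⟩)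
    · simp
    · exact G.irrefl x

/-- There is an isomorphism `f` from `G_I` onto `G'_I` with `f(I) = I`. -/
def ContractIsoFix (G G' : Dgraph V) (I : Set V) : Prop :=
  ∃ e : Option {x : V // x ∉ I} ≃ Option {x : V // x ∉ I},
    e none = none ∧ ∀ a b, (G.contract I).Arc a b ↔ (G'.contract I).Arc (e a) (e b)

/-- `D` is disjoint from every flag of `G`. -/
def FlagDisjoint (G : Dgraph V) (D : Set V) : Prop :=
  ∀ F : Set V, IsFlag (G.ind F) → D ∩ F = ∅

/-- `D` contains a vertex `a` of a flag `{a,b,c}` of `G` with `b, c ∉ D` and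
`{b,c}` the directed pair of the flag. -/
def FlagVertexCond (G : Dgraph V) (D : Set V) : Prop :=
  ∃ a ∈ D, ∃ b c : V, b ∉ D ∧ c ∉ D ∧ IsFlag (G.ind {a, b, c}) ∧ G.Dir b c

/-- Condition `C_∞`. -/
def CondCinf (G : Dgraph V) : Prop :=
  (∃ I : Set V, I.Infinite ∧ G.IsInterval I ∧ (G.ind I).IsChainD) ∨
  (∃ I J : Set V, I ≠ J ∧ G.IsInterval I ∧ G.IsInterval J ∧
     (G.ind I).OneEndInfiniteConsecutivity ∧ (G.ind J).OneEndInfiniteConsecutivity) ∨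
  (∃ I : Set V, G.IsInterval I ∧ (G.ind I).OneEndInfiniteConsecutivity ∧
     (∀ J : Set V, G.IsInterval J → (G.ind J).OneEndInfiniteConsecutivity → J = I) ∧
     ¬ ContractIsoFix G G.dual I)

/-- The kind of component occurring in conditions `K1` and `K2`. -/
def K12Kind (G : Dgraph V) (D : Set V) : Prop :=
  DiamondFreeTournament (G.ind D) ∨ (NonTournamentPrechain (G.ind D) ∧ G.FlagDisjoint D)

/-- Condition `K1`. -/
def CondK1 (G : Dgraph V) : Prop :=
  G.Cdual = 3 ∧ ∃ D₁ D₂ : Set V, D₁ ≠ D₂ ∧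
    (G.IsACComponent D₁ ∧ ¬ SelfDual (G.ind D₁) ∧ G.IsInterval D₁ ∧ G.K12Kind D₁) ∧
    (G.IsACComponent D₂ ∧ ¬ SelfDual (G.ind D₂) ∧ G.IsInterval D₂ ∧ G.K12Kind D₂)

/-- Condition `K2`. -/
def CondK2 (G : Dgraph V) : Prop :=
  G.Cdual = 3 ∧ ∃ D₀ : Set V, G.IsACComponent D₀ ∧ ¬ SelfDual (G.ind D₀) ∧
    (∀ D, G.IsACComponent D → ¬ SelfDual (G.ind D) → D = D₀) ∧
    G.K12Kind D₀ ∧ ¬ ContractIsoFix G G.dual D₀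

/-- Condition `K3`. -/
def CondK3 (G : Dgraph V) : Prop :=
  G.Cdual = 4 ∧ ∃ D₁ D₂ : Set V, D₁ ≠ D₂ ∧
    (G.IsACComponent D₁ ∧ ¬ SelfDual (G.ind D₁) ∧ G.IsInterval D₁) ∧
    (G.IsACComponent D₂ ∧ ¬ SelfDual (G.ind D₂) ∧ G.IsInterval D₂)

/-- Condition `K4`. -/
def CondK4 (G : Dgraph V) : Prop :=
  G.Cdual = 5 ∧ ∃ D₁ D₂ : Set V, D₁ ≠ D₂ ∧
    (G.IsACComponent D₁ ∧ ¬ SelfDual (G.ind D₁) ∧ G.IsInterval D₁ ∧ IsPrechain (G.ind D₁)) ∧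
    (G.IsACComponent D₂ ∧ ¬ SelfDual (G.ind D₂) ∧ G.IsInterval D₂ ∧ IsPrechain (G.ind D₂))

/-- Condition `K5`. -/
def CondK5 (G : Dgraph V) : Prop :=
  G.Cdual = 6 ∧ ∃ D₁ D₂ : Set V, D₁ ≠ D₂ ∧
    (G.IsACComponent D₁ ∧ ¬ SelfDual (G.ind D₁) ∧ G.IsInterval D₁ ∧
      DiamondFreeTournament (G.ind D₁)) ∧
    (G.IsACComponent D₂ ∧ ¬ SelfDual (G.ind D₂) ∧ G.IsInterval D₂ ∧
      DiamondFreeTournament (G.ind D₂))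

/-- The kind of interval occurring in conditions `L1` and `L2`. -/
def L12Int (G : Dgraph V) (I : Set V) : Prop :=
  G.IsInterval I ∧ DiamondFreeTournament (G.ind I) ∧ ¬ SelfDual (G.ind I) ∧
    ¬ G.IsACComponent I

/-- Condition `L1`. -/
def CondL1 (G : Dgraph V) : Prop :=
  ∃ I₁ I₂ : Set V, I₁ ≠ I₂ ∧ G.L12Int I₁ ∧ G.L12Int I₂

/-- Condition `L2`. -/
def CondL2 (G : Dgraph V) : Prop :=
  ∃ I₀ : Set V, G.L12Int I₀ ∧ (∀ I, G.L12Int I → I = I₀) ∧ ¬ ContractIsoFix G G.dual I₀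

/-- Condition `L3`. -/
def CondL3 (G : Dgraph V) : Prop :=
  G.Cdual = 3 ∧ ∃ D₁ D₂ : Set V, D₁ ≠ D₂ ∧
    (G.IsACComponent D₁ ∧ ¬ SelfDual (G.ind D₁) ∧ G.IsInterval D₁) ∧
    (G.IsACComponent D₂ ∧ ¬ SelfDual (G.ind D₂) ∧ G.IsInterval D₂) ∧
    ((G.FlagDisjoint D₁ ∧ Cdual (G.ind D₁) = 4 ∧ G.FlagDisjoint D₂ ∧ Cdual (G.ind D₂) = 4) ∨
     (NonTournamentPrechain (G.ind D₁) ∧ G.FlagVertexCond D₁ ∧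
      NonTournamentPrechain (G.ind D₂) ∧ G.FlagVertexCond D₂))

/-- Condition `L4`. -/
def CondL4 (G : Dgraph V) : Prop :=
  G.Cdual = 3 ∧ ∃ D₀ : Set V, G.IsACComponent D₀ ∧ ¬ SelfDual (G.ind D₀) ∧
    (∀ D, G.IsACComponent D → ¬ SelfDual (G.ind D) → D = D₀) ∧
    G.IsInterval D₀ ∧
    ((G.FlagDisjoint D₀ ∧ Cdual (G.ind D₀) = 4) ∨
     (NonTournamentPrechain (G.ind D₀) ∧ G.FlagVertexCond D₀)) ∧
    ¬ ContractIsoFix G G.dual D₀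

end Dgraph

open Dgraph

namespace Dgraph

variable {V : Type u}

/-- The relative position of an ordered pair of vertices in two `{2}`-hemimorphic digraphs: full,
void, or a directed pair, forward or backward, preserved or reversed by the second digraph. -/
inductive PairCode
  | full | void | fwdKept | fwdRev | bwdKept | bwdRev
  deriving DecidableEq

namespace PairCode

/-- The code of the opposite ordered pair. -/
def swap : PairCode → PairCode
  | full => full | void => void
  | fwdKept => bwdKept | fwdRev => bwdRev | bwdKept => fwdKept | bwdRev => fwdRev

/-- The code obtained when the second digraph is replaced by its dual. -/
def flip : PairCode → PairCode
  | full => full | void => void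
  | fwdKept => fwdRev | fwdRev => fwdKept | bwdKept => bwdRev | bwdRev => bwdKept

/-- Presence of the arc in the first digraph. -/
def fst : PairCode → Bool
  | full => true | void => false
  | fwdKept => true | fwdRev => true | bwdKept => false | bwdRev => false

/-- Presence of the arc in the second digraph. -/
def snd : PairCode → Bool
  | full => true | void => false
  | fwdKept => true | fwdRev => false | bwdKept => false | bwdRev => true

/-- The pair is directed and reversed. -/
def isRev : PairCode → Bool
  | fwdRev => true | bwdRev => true | _ => false

/-- The pair is directed and kept. -/
def isKept : PairCode → Bool
  | fwdKept => true | bwdKept => true | _ => false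

/-- The type of the first pair in the first digraph is that of the second pair in the second
digraph. -/
def isoMatch (p q : PairCode) : Bool := p.fst == q.snd && p.swap.fst == q.swap.snd

/-- The type of the first pair in the dual of the first digraph is that of the second pair in the
second digraph. -/
def dualMatch (p q : PairCode) : Bool := isoMatch p.swap q

instance decidableForall (P : PairCode → Prop) [DecidablePred P] : Decidable (∀ p, P p) :=
  decidable_of_iff (P full ∧ P void ∧ P fwdKept ∧ P fwdRev ∧ P bwdKept ∧ P bwdRev)
    ⟨fun h p => by cases p <;> simp [h], fun h => by simp [h]⟩

end PairCode

open PairCode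

/-- The code of the pair `(i, j)` in the table with upper triangle `u`, listed by columns. -/
def tab (u : List PairCode) (i j : ℕ) : PairCode :=
  if i < j then u.getD (j * (j - 1) / 2 + i) void
  else if j < i then (u.getD (i * (i - 1) / 2 + j) void).swap
  else void

/-- Backtracking search for the extension by `k` values of a partial morphism, given by the list
of its first values. -/
def search (n : ℕ) (t : ℕ → ℕ → PairCode) (m : PairCode → PairCode → Bool) : ℕ → List ℕ → Bool
  | 0, _ => true
  | k + 1, l => (List.range n).any fun j =>
      !(l.contains j) &&
        ((List.range l.length).all fun i => m (t i l.length) (t (l.getD i 0) j)) &&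
        search n t m k (l ++ [j])

theorem search_eq_true {n : ℕ} {t : ℕ → ℕ → PairCode} {m : PairCode → PairCode → Bool} {f : ℕ → ℕ}
    (hlt : ∀ i < n, f i < n) (hinj : ∀ i < n, ∀ j < n, f i = f j → i = j)
    (hm : ∀ i < n, ∀ j < n, m (t i j) (t (f i) (f j)) = true) (k : ℕ) (hk : k ≤ n) :
    search n t m k ((List.range (n - k)).map f) = true := by
  induction k with
  | zero => rfl
  | succ k ih =>
    have hn : n - k = (n - (k + 1)) + 1 := by omega
    rw [search, List.any_eq_true]
    refine ⟨f (n - (k + 1)), List.mem_range.2 (hlt _ (by omega)), ?_⟩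
    have h3 := ih (by omega)
    rw [hn, List.range_succ, List.map_append] at h3
    simp only [Bool.and_eq_true]
    refine ⟨⟨?_, ?_⟩, h3⟩
    · simp only [Bool.not_eq_true', List.contains_eq_mem, decide_eq_false_iff_not, List.mem_map,
        List.mem_range, not_exists, not_and]
      intro i hi h
      have := hinj i (by omega) _ (by omega) h
      omega
    · simp only [List.length_map, List.length_range, List.all_eq_true, List.mem_range]
      intro i hi
      have : ((List.range (n - (k + 1))).map f).getD i 0 = f i := by
        simp [List.getD_eq_getElem?_getD, hi]
      rw [this]
      exact hm i (by omega) _ (by omega)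

/-- The two digraphs coded by `u` on `n` vertices are hemimorphic. -/
def hemiTab (n : ℕ) (u : List PairCode) : Bool :=
  search n (tab u) isoMatch n [] || search n (tab u) dualMatch n []

/-- The codes of a pair of `(≤ 6)`-hemimorphic digraphs. -/
structure HemiCoding (c : V → V → PairCode) : Prop where
  self : ∀ x, c x x = void
  swap : ∀ x y, c y x = (c x y).swap
  hemi : ∀ L : List V, L.Nodup → L.length ≤ 6 → ∃ f : V → V, Set.BijOn f {x | x ∈ L} {x | x ∈ L} ∧
    ((∀ x ∈ L, ∀ y ∈ L, isoMatch (c x y) (c (f x) (f y)) = true) ∨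
      (∀ x ∈ L, ∀ y ∈ L, dualMatch (c x y) (c (f x) (f y)) = true))

variable {c : V → V → PairCode}

theorem HemiCoding.flip (h : HemiCoding c) : HemiCoding (fun x y => (c x y).flip) where
  self x := by simp [h.self, PairCode.flip]
  swap x y := by rw [h.swap x y]; cases c x y <;> rfl
  hemi L hL hl := by
    obtain ⟨f, hf, h1⟩ := h.hemi L hL hl
    have key : ∀ p q : PairCode, isoMatch p.flip q.flip = dualMatch p q ∧
        dualMatch p.flip q.flip = isoMatch p q := by
      intro p q; cases p <;> cases q <;> decide
    refine ⟨f, hf, h1.symm.imp ?_ ?_⟩ <;> intro h2 x hx y hy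
    · rw [(key _ _).1]; exact h2 x hx y hy
    · rw [(key _ _).2]; exact h2 x hx y hy

theorem tab_eq (h : HemiCoding c) {L : List V} {u : List PairCode}
    (hu : ∀ j (hj : j < L.length) i (hi : i < j),
      u.getD (j * (j - 1) / 2 + i) void = c (L[i]) (L[j]))
    {i j : ℕ} (hi : i < L.length) (hj : j < L.length) : tab u i j = c L[i] L[j] := by
  unfold tab
  split_ifs with h1 h2
  · exact hu j hj i h1
  · rw [hu i hi j h2, ← h.swap]
  · obtain rfl : i = j := by omega
    exact (h.self _).symm

theorem search_of_bijOn (h : HemiCoding c) {L : List V} (hL : L.Nodup) {u : List PairCode}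
    (hu : ∀ j (hj : j < L.length) i (hi : i < j),
      u.getD (j * (j - 1) / 2 + i) void = c (L[i]) (L[j]))
    {f : V → V} (hf : Set.BijOn f {x | x ∈ L} {x | x ∈ L}) {m : PairCode → PairCode → Bool}
    (hm : ∀ x ∈ L, ∀ y ∈ L, m (c x y) (c (f x) (f y)) = true) :
    search L.length (tab u) m L.length [] = true := by
  have hex : ∀ i, ∃ k, ∀ hi : i < L.length, ∃ hk : k < L.length, L[k] = f L[i] := by
    intro i
    by_cases hi : i < L.length
    · obtain ⟨k, hk, e⟩ := List.getElem_of_mem (hf.mapsTo (List.getElem_mem hi))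
      exact ⟨k, fun _ => ⟨hk, e⟩⟩
    · exact ⟨0, fun h => absurd h hi⟩
  choose g hg using hex
  have := search_eq_true (n := L.length) (t := tab u) (m := m) (f := g)
    (fun i hi => (hg i hi).1) (fun i hi j hj hij => ?_) (fun i hi j hj => ?_) L.length le_rfl
  · simpa using this
  · obtain ⟨h1, h2⟩ := hg i hi
    obtain ⟨h3, h4⟩ := hg j hj
    have h5 : f L[i] = f L[j] := by rw [← h2, ← h4]; simp [hij]
    have := hf.injOn (List.getElem_mem hi) (List.getElem_mem hj) h5
    exact (List.Nodup.getElem_inj_iff hL).1 this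
  · obtain ⟨h1, h2⟩ := hg i hi
    obtain ⟨h3, h4⟩ := hg j hj
    rw [tab_eq h hu hi hj, tab_eq h hu h1 h3, h2, h4]
    exact hm _ (List.getElem_mem hi) _ (List.getElem_mem hj)

theorem HemiCoding.hemiTab (h : HemiCoding c) {L : List V} (hL : L.Nodup) (hl : L.length ≤ 6)
    {u : List PairCode}
    (hu : ∀ j (hj : j < L.length) i (hi : i < j),
      u.getD (j * (j - 1) / 2 + i) void = c (L[i]) (L[j])) :
    Dgraph.hemiTab L.length u = true := by
  obtain ⟨f, hf, h1⟩ := h.hemi L hL hl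
  rw [Dgraph.hemiTab, Bool.or_eq_true]
  exact h1.imp (search_of_bijOn h hL hu hf) (search_of_bijOn h hL hu hf)

theorem HemiCoding.hemi₃ (h : HemiCoding c) {x y z : V} (hL : [x, y, z].Nodup) :
    Dgraph.hemiTab 3 [c x y, c x z, c y z] = true := by
  refine h.hemiTab hL (by simp) (u := [c x y, c x z, c y z]) ?_
  intro j hj i hi
  simp only [List.length_cons, List.length_nil] at hj
  interval_cases j <;> interval_cases i <;> rfl

theorem HemiCoding.hemi₄ (h : HemiCoding c) {x y z t : V} (hL : [x, y, z, t].Nodup) :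
    Dgraph.hemiTab 4 [c x y, c x z, c y z, c x t, c y t, c z t] = true := by
  refine h.hemiTab hL (by simp) (u := [c x y, c x z, c y z, c x t, c y t, c z t]) ?_
  intro j hj i hi
  simp only [List.length_cons, List.length_nil] at hj
  interval_cases j <;> interval_cases i <;> rfl

theorem HemiCoding.hemi₅ (h : HemiCoding c) {x y z t s : V} (hL : [x, y, z, t, s].Nodup) :
    Dgraph.hemiTab 5
      [c x y, c x z, c y z, c x t, c y t, c z t, c x s, c y s, c z s, c t s] = true := by
  refine h.hemiTab hL (by simp)
    (u := [c x y, c x z, c y z, c x t, c y t, c z t, c x s, c y s, c z s, c t s]) ?_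
  intro j hj i hi
  simp only [List.length_cons, List.length_nil] at hj
  interval_cases j <;> interval_cases i <;> rfl

theorem HemiCoding.hemi₆ (h : HemiCoding c) {x y z t s r : V} (hL : [x, y, z, t, s, r].Nodup) :
    Dgraph.hemiTab 6
      [c x y, c x z, c y z, c x t, c y t, c z t, c x s, c y s, c z s, c t s,
        c x r, c y r, c z r, c t r, c s r] = true := by
  refine h.hemiTab hL (by simp)
    (u := [c x y, c x z, c y z, c x t, c y t, c z t, c x s, c y s, c z s, c t s,
      c x r, c y r, c z r, c t r, c s r]) ?_
  intro j hj i hi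
  simp only [List.length_cons, List.length_nil] at hj
  interval_cases j <;> interval_cases i <;> rfl

theorem twin_of_flag_of_isRev_apex : ∀ p q : PairCode, p.isKept → q.isRev →
    ∀ r, hemiTab 3 [full, q, r] → ∀ s, hemiTab 3 [void, q, s] → hemiTab 3 [p, r, s] →
    hemiTab 4 [full, void, p, q, r, s] → r = full ∧ s = void := by
  decide +kernel

theorem twin_of_flag_of_isRev_left : ∀ p r : PairCode, p.isKept → r.isRev →
    ∀ q, hemiTab 3 [full, q, r] → ∀ s, hemiTab 3 [void, q, s] → hemiTab 3 [p, r, s] →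
    hemiTab 4 [full, void, p, q, r, s] → q = full ∧ s = p.swap := by
  decide +kernel

theorem twin_of_flag_of_isRev_right : ∀ p s : PairCode, p.isKept → s.isRev →
    ∀ q, hemiTab 3 [void, q, s] → ∀ r, hemiTab 3 [full, q, r] → hemiTab 3 [p, r, s] →
    hemiTab 4 [full, void, p, q, r, s] → q = void ∧ r = p := by
  decide +kernel

/-- A kept flag with apex `a`, the vertex `b` being fully joined to `a`. -/
structure KeptFlag (c : V → V → PairCode) (a b d : V) : Prop where
  ab : c a b = full
  ad : c a d = void
  bd : (c b d).isKept = true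

/-- A reversed flag with apex `a`, the vertex `b` being fully joined to `a`. -/
structure RevFlag (c : V → V → PairCode) (a b d : V) : Prop where
  ab : c a b = full
  ad : c a d = void
  bd : (c b d).isRev = true

/-- A reversed peak with apex `x`. -/
structure RevPeak (c : V → V → PairCode) (x y z : V) : Prop where
  xy : (c x y).isRev = true
  eq : c x z = c x y
  ne : y ≠ z
  yz : c y z = full ∨ c y z = void

/-- The codes `full` and `void`, in some order. -/
def Split (t t' : PairCode) : Prop := t = full ∧ t' = void ∨ t = void ∧ t' = full

instance (t t' : PairCode) : Decidable (Split t t') := by unfold Split; infer_instance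

theorem not_hemiTab_of_isRev_apex : ∀ p q : PairCode, p.isKept → q.isRev → ∀ t t', Split t t' →
    ∀ r, hemiTab 3 [full, t, r] → hemiTab 3 [full, r, t'] →
    ∀ s, hemiTab 3 [void, t, s] → hemiTab 3 [p, r, s] → hemiTab 3 [void, s, t'] →
    hemiTab 4 [full, void, p, t, r, s] → hemiTab 4 [full, q, full, t, r, t'] →
    hemiTab 4 [void, q, void, t, s, t'] →
    ¬ hemiTab 5 [full, void, p, q, full, void, t, r, s, t'] := by
  decide +kernel

theorem not_hemiTab_of_isRev_left : ∀ p q : PairCode, p.isKept → q.isRev → ∀ t t', Split t t' →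
    ∀ r, hemiTab 3 [full, r, t] → hemiTab 3 [full, r, t'] →
    ∀ s, hemiTab 3 [void, r, s] → hemiTab 3 [p, t, s] → hemiTab 3 [p.swap, s, t'] →
    hemiTab 4 [full, void, p, r, t, s] → hemiTab 4 [full, full, q, r, t, t'] →
    hemiTab 4 [p, q, p.swap, t, s, t'] →
    ¬ hemiTab 5 [full, void, p, full, q, p.swap, r, t, s, t'] := by
  decide +kernel

theorem not_hemiTab_of_isRev_right : ∀ p q : PairCode, p.isKept → q.isRev → ∀ t t', Split t t' →
    ∀ r, hemiTab 3 [void, r, t] → hemiTab 3 [void, r, t'] →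
    ∀ s, hemiTab 3 [full, r, s] → hemiTab 3 [p, s, t] → hemiTab 3 [p, s, t'] →
    hemiTab 4 [full, void, p, r, s, t] → hemiTab 4 [void, void, q, r, t, t'] →
    hemiTab 4 [p, p, q, s, t, t'] →
    ¬ hemiTab 5 [full, void, p, void, p, q, r, s, t, t'] := by
  decide +kernel

theorem not_hemiTab_of_apex : ∀ p q : PairCode, p.isKept → q.isRev →
    ∀ r, hemiTab 3 [full, full, r] → ∀ s, hemiTab 3 [void, full, s] → hemiTab 3 [p, r, s] →
    hemiTab 4 [full, void, p, full, r, s] →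
    ∀ t, hemiTab 3 [full, void, t] → hemiTab 3 [r, t, q] → hemiTab 4 [full, full, r, void, t, q] →
    ∀ t', hemiTab 3 [void, void, t'] → hemiTab 3 [s, t', q] → hemiTab 3 [p, t, t'] →
    hemiTab 4 [void, full, s, void, t', q] → hemiTab 4 [full, void, p, void, t, t'] →
    ¬ hemiTab 5 [full, void, p, full, r, s, void, t, t', q] := by
  decide +kernel

/-- The pair is full or void. -/
def PairCode.Neutral (t : PairCode) : Prop := t = full ∨ t = void

instance (t : PairCode) : Decidable t.Neutral := by unfold PairCode.Neutral; infer_instance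

theorem not_hemiTab_of_flags : ∀ p q : PairCode, p.isKept → q.isRev →
    ∀ r, r.Neutral → ∀ s, s.Neutral → ∀ t, t.Neutral → ∀ t', t'.Neutral →
    ¬ hemiTab 6 [full, void, p, r, s, s, t, t', t', full, t, t', t', void, q] := by
  decide +kernel

theorem not_hemiTab_of_flag_of_peak : ∀ p q t : PairCode, p.isKept → q.isRev → t.Neutral →
    ∀ r, ¬ r.isRev → ∀ s, ¬ s.isRev → ∀ t', ¬ t'.isRev →
    ¬ hemiTab 6 [full, void, p, r, s, t', r, s, t', q, r, s, t', q, t] := by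
  decide +kernel

theorem not_search_of_flag : ∀ q : PairCode, q.isRev →
    ¬ search 3 (tab [full, void, q]) isoMatch 3 [] := by
  decide +kernel

theorem not_search_of_peak : ∀ q t : PairCode, q.isRev → t.Neutral →
    ¬ search 3 (tab [q, q, t]) isoMatch 3 [] := by
  decide +kernel

theorem eq_of_isRev : ∀ p : PairCode, p.isRev → ∀ r, ¬ r.isRev → ∀ s, ¬ s.isRev →
    ¬ Split r s → hemiTab 3 [r, s, p] → r = s := by
  decide +kernel

theorem HemiCoding.isRev_swap (h : HemiCoding c) {x y : V} (hr : (c x y).isRev) :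
    (c y x).isRev := by
  rw [h.swap x y]; revert hr; cases c x y <;> simp [isRev, PairCode.swap]

theorem HemiCoding.isKept_swap (h : HemiCoding c) {x y : V} (hr : (c x y).isKept) :
    (c y x).isKept := by
  rw [h.swap x y]; revert hr; cases c x y <;> simp [isKept, PairCode.swap]

theorem HemiCoding.full_swap (h : HemiCoding c) {x y : V} (hr : c x y = full) : c y x = full := by
  rw [h.swap x y, hr]; rfl

theorem HemiCoding.void_swap (h : HemiCoding c) {x y : V} (hr : c x y = void) : c y x = void := by
  rw [h.swap x y, hr]; rfl

theorem HemiCoding.eq_swap (h : HemiCoding c) {x y z t : V} (hr : c x y = c z t) :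
    c y x = c t z := by
  rw [h.swap x y, hr, ← h.swap]

theorem RevFlag.flip {a b d : V} (F : RevFlag c a b d) :
    KeptFlag (fun x y => (c x y).flip) a b d where
  ab := by simp [F.ab, PairCode.flip]
  ad := by simp [F.ad, PairCode.flip]
  bd := by have := F.bd; revert this; cases c b d <;> simp [isRev, isKept, PairCode.flip]

theorem KeptFlag.flip {a b d : V} (F : KeptFlag c a b d) :
    RevFlag (fun x y => (c x y).flip) a b d where
  ab := by simp [F.ab, PairCode.flip]
  ad := by simp [F.ad, PairCode.flip]
  bd := by have := F.bd; revert this; cases c b d <;> simp [isRev, isKept, PairCode.flip]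

section

variable {a b d e : V}

theorem KeptFlag.ne_left (h : HemiCoding c) (F : KeptFlag c a b d) : a ≠ b := by
  rintro rfl; have := F.ab; simp [h.self] at this

theorem KeptFlag.ne_right (h : HemiCoding c) (F : KeptFlag c a b d) : a ≠ d := by
  rintro rfl; have := F.bd; simp [h.full_swap F.ab, isKept] at this

theorem KeptFlag.ne (h : HemiCoding c) (F : KeptFlag c a b d) : b ≠ d := by
  rintro rfl; have := F.bd; simp [h.self, isKept] at this

theorem KeptFlag.replace_apex (h : HemiCoding c) (F : KeptFlag c a b d) (he : (c a e).isRev) :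
    KeptFlag c e b d := by
  have h1 : e ≠ a := by rintro rfl; simp [h.self, isRev] at he
  have h2 : e ≠ b := by rintro rfl; simp [F.ab, isRev] at he
  have h3 : e ≠ d := by rintro rfl; simp [F.ad, isRev] at he
  have n1 := F.ne_left h
  have n2 := F.ne_right h
  have n3 := F.ne h
  have := twin_of_flag_of_isRev_apex (c b d) (c a e) F.bd he (c b e)
    (by rw [← F.ab]; exact h.hemi₃ (by simp; tauto)) (c d e)
    (by rw [← F.ad]; exact h.hemi₃ (by simp; tauto)) (h.hemi₃ (by simp; tauto))
    (by rw [← F.ab, ← F.ad]; exact h.hemi₄ (by simp; tauto))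
  exact ⟨h.full_swap this.1, h.void_swap this.2, F.bd⟩

theorem KeptFlag.replace_left (h : HemiCoding c) (F : KeptFlag c a b d) (he : (c b e).isRev) :
    KeptFlag c a e d ∧ c e d = c b d := by
  have h1 : e ≠ a := by rintro rfl; simp [h.full_swap F.ab, isRev] at he
  have h2 : e ≠ b := by rintro rfl; simp [h.self, isRev] at he
  have h3 : e ≠ d := by
    rintro rfl; have := F.bd; revert this he; cases c b e <;> simp [isRev, isKept]
  have n1 := F.ne_left h
  have n2 := F.ne_right h
  have n3 := F.ne h
  have := twin_of_flag_of_isRev_left (c b d) (c b e) F.bd he (c a e)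
    (by rw [← F.ab]; exact h.hemi₃ (by simp; tauto)) (c d e)
    (by rw [← F.ad]; exact h.hemi₃ (by simp; tauto)) (h.hemi₃ (by simp; tauto))
    (by rw [← F.ab, ← F.ad]; exact h.hemi₄ (by simp; tauto))
  have h4 : c e d = c b d := h.eq_swap (by rw [this.2, ← h.swap])
  exact ⟨⟨this.1, F.ad, by rw [h4]; exact F.bd⟩, h4⟩

theorem KeptFlag.replace_right (h : HemiCoding c) (F : KeptFlag c a b d) (he : (c d e).isRev) :
    KeptFlag c a b e ∧ c b e = c b d := by
  have h1 : e ≠ a := by rintro rfl; simp [h.void_swap F.ad, isRev] at he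
  have h2 : e ≠ b := by
    rintro rfl; have := h.isKept_swap F.bd; revert this he; cases c d e <;> simp [isRev, isKept]
  have h3 : e ≠ d := by rintro rfl; simp [h.self, isRev] at he
  have n1 := F.ne_left h
  have n2 := F.ne_right h
  have n3 := F.ne h
  have := twin_of_flag_of_isRev_right (c b d) (c d e) F.bd he (c a e)
    (by rw [← F.ad]; exact h.hemi₃ (by simp; tauto)) (c b e)
    (by rw [← F.ab]; exact h.hemi₃ (by simp; tauto)) (h.hemi₃ (by simp; tauto))
    (by rw [← F.ab, ← F.ad]; exact h.hemi₄ (by simp; tauto))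
  exact ⟨⟨F.ab, this.1, by rw [this.2]; exact F.bd⟩, this.2⟩

end

/-- Two vertices joined by a path of reversed pairs. -/
def RevRel (c : V → V → PairCode) : V → V → Prop :=
  Relation.ReflTransGen fun x y => (c x y).isRev = true

section

variable {a b d e : V}

theorem KeptFlag.apex_of_revRel (h : HemiCoding c) (F : KeptFlag c a b d) (he : RevRel c a e) :
    KeptFlag c e b d := by
  induction he with
  | refl => exact F
  | tail _ h2 ih => exact ih.replace_apex h h2

theorem KeptFlag.left_of_revRel (h : HemiCoding c) (F : KeptFlag c a b d) (he : RevRel c b e) :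
    KeptFlag c a e d ∧ c e d = c b d := by
  induction he with
  | refl => exact ⟨F, rfl⟩
  | tail _ h2 ih => exact ⟨(ih.1.replace_left h h2).1, (ih.1.replace_left h h2).2.trans ih.2⟩

theorem KeptFlag.right_of_revRel (h : HemiCoding c) (F : KeptFlag c a b d) (he : RevRel c d e) :
    KeptFlag c a b e ∧ c b e = c b d := by
  induction he with
  | refl => exact ⟨F, rfl⟩
  | tail _ h2 ih => exact ⟨(ih.1.replace_right h h2).1, (ih.1.replace_right h h2).2.trans ih.2⟩

variable {u w : V}

theorem Split.neutral_ne {t t' : PairCode} (h : Split t t') : t ≠ t' := by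
  rintro rfl; rcases h with ⟨h1, h2⟩ | ⟨h1, h2⟩ <;> simp [h1] at h2

theorem Split.isRev_eq_false {t t' : PairCode} (h : Split t t') :
    t.isRev = false ∧ t'.isRev = false := by
  rcases h with ⟨rfl, rfl⟩ | ⟨rfl, rfl⟩ <;> decide

theorem HemiCoding.ne_of_isRev (h : HemiCoding c) {x y : V} (hr : (c x y).isRev) : x ≠ y := by
  rintro rfl; simp [h.self, isRev] at hr

theorem Split.ne_of_isRev (h : HemiCoding c) {x y z : V} (hr : (c x y).isRev)
    (hs : Split (c x z) (c y z)) : z ≠ x ∧ z ≠ y := by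
  constructor
  · rintro rfl
    have := (hs.isRev_eq_false).2
    rw [h.isRev_swap hr] at this
    simp at this
  · rintro rfl
    have := (hs.isRev_eq_false).1
    rw [hr] at this
    simp at this

theorem KeptFlag.not_isRev_apex (h : HemiCoding c) (F : KeptFlag c a b d) (hw : (c a w).isRev)
    (hs : Split (c a u) (c w u)) : False := by
  have F' := F.replace_apex h hw
  have n1 := F.ne_left h
  have n2 := F.ne_right h
  have n3 := F.ne h
  have n4 := F'.ne_left h
  have n5 := F'.ne_right h
  have n6 := h.ne_of_isRev hw
  have n7 : u ≠ b := by rintro rfl; exact hs.neutral_ne (by rw [F.ab, F'.ab])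
  have n8 : u ≠ d := by rintro rfl; exact hs.neutral_ne (by rw [F.ad, F'.ad])
  obtain ⟨n9, n10⟩ := hs.ne_of_isRev h hw
  have e1 := F.ab
  have e2 := F.ad
  have e3 := h.full_swap F'.ab
  have e4 := h.void_swap F'.ad
  refine not_hemiTab_of_isRev_apex (c b d) (c a w) F.bd hw (c a u) (c w u) hs (c b u) ?_ ?_ (c d u)
    ?_ ?_ ?_ ?_ ?_ ?_ ?_
  · simpa only [e1] using h.hemi₃ (x := a) (y := b) (z := u) (by simp; tauto)
  · simpa only [e3] using h.hemi₃ (x := b) (y := w) (z := u) (by simp; tauto)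
  · simpa only [e2] using h.hemi₃ (x := a) (y := d) (z := u) (by simp; tauto)
  · exact h.hemi₃ (by simp; tauto)
  · simpa only [e4] using h.hemi₃ (x := d) (y := w) (z := u) (by simp; tauto)
  · simpa only [e1, e2] using h.hemi₄ (x := a) (y := b) (z := d) (t := u) (by simp; tauto)
  · simpa only [e1, e3] using h.hemi₄ (x := a) (y := b) (z := w) (t := u) (by simp; tauto)
  · simpa only [e2, e4] using h.hemi₄ (x := a) (y := d) (z := w) (t := u) (by simp; tauto)
  · simpa only [e1, e2, e3, e4] using
      h.hemi₅ (x := a) (y := b) (z := d) (t := w) (s := u) (by simp; tauto)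

theorem KeptFlag.not_isRev_left (h : HemiCoding c) (F : KeptFlag c a b d) (hw : (c b w).isRev)
    (hs : Split (c b u) (c w u)) : False := by
  obtain ⟨F', hp⟩ := F.replace_left h hw
  have n1 := F.ne_left h
  have n2 := F.ne_right h
  have n3 := F.ne h
  have n4 := F'.ne_left h
  have n5 := F'.ne h
  have n6 := h.ne_of_isRev hw
  have n7 : u ≠ a := by
    rintro rfl; exact hs.neutral_ne (by rw [h.full_swap F.ab, h.full_swap F'.ab])
  have n8 : u ≠ d := by rintro rfl; exact hs.neutral_ne hp.symm
  obtain ⟨n9, n10⟩ := hs.ne_of_isRev h hw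
  have e1 := F.ab
  have e2 := F.ad
  have e3 := F'.ab
  have e4 : c d w = (c b d).swap := by rw [← hp, ← h.swap]
  refine not_hemiTab_of_isRev_left (c b d) (c b w) F.bd hw (c b u) (c w u) hs (c a u) ?_ ?_ (c d u)
    ?_ ?_ ?_ ?_ ?_ ?_ ?_
  · simpa only [e1] using h.hemi₃ (x := a) (y := b) (z := u) (by simp; tauto)
  · simpa only [e3] using h.hemi₃ (x := a) (y := w) (z := u) (by simp; tauto)
  · simpa only [e2] using h.hemi₃ (x := a) (y := d) (z := u) (by simp; tauto)
  · exact h.hemi₃ (by simp; tauto)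
  · simpa only [e4] using h.hemi₃ (x := d) (y := w) (z := u) (by simp; tauto)
  · simpa only [e1, e2] using h.hemi₄ (x := a) (y := b) (z := d) (t := u) (by simp; tauto)
  · simpa only [e1, e3] using h.hemi₄ (x := a) (y := b) (z := w) (t := u) (by simp; tauto)
  · simpa only [e4] using h.hemi₄ (x := b) (y := d) (z := w) (t := u) (by simp; tauto)
  · simpa only [e1, e2, e3, e4] using
      h.hemi₅ (x := a) (y := b) (z := d) (t := w) (s := u) (by simp; tauto)

theorem KeptFlag.not_isRev_right (h : HemiCoding c) (F : KeptFlag c a b d) (hw : (c d w).isRev)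
    (hs : Split (c d u) (c w u)) : False := by
  obtain ⟨F', hp⟩ := F.replace_right h hw
  have n1 := F.ne_left h
  have n2 := F.ne_right h
  have n3 := F.ne h
  have n4 := F'.ne_right h
  have n5 := F'.ne h
  have n6 := h.ne_of_isRev hw
  have n7 : u ≠ a := by
    rintro rfl; exact hs.neutral_ne (by rw [h.void_swap F.ad, h.void_swap F'.ad])
  have n8 : u ≠ b := by rintro rfl; exact hs.neutral_ne (h.eq_swap hp.symm)
  obtain ⟨n9, n10⟩ := hs.ne_of_isRev h hw
  have e1 := F.ab
  have e2 := F.ad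
  have e3 := F'.ad
  refine not_hemiTab_of_isRev_right (c b d) (c d w) F.bd hw (c d u) (c w u) hs (c a u) ?_ ?_ (c b u)
    ?_ ?_ ?_ ?_ ?_ ?_ ?_
  · simpa only [e2] using h.hemi₃ (x := a) (y := d) (z := u) (by simp; tauto)
  · simpa only [e3] using h.hemi₃ (x := a) (y := w) (z := u) (by simp; tauto)
  · simpa only [e1] using h.hemi₃ (x := a) (y := b) (z := u) (by simp; tauto)
  · exact h.hemi₃ (by simp; tauto)
  · simpa only [hp] using h.hemi₃ (x := b) (y := w) (z := u) (by simp; tauto)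
  · simpa only [e1, e2] using h.hemi₄ (x := a) (y := b) (z := d) (t := u) (by simp; tauto)
  · simpa only [e2, e3] using h.hemi₄ (x := a) (y := d) (z := w) (t := u) (by simp; tauto)
  · simpa only [hp] using h.hemi₄ (x := b) (y := d) (z := w) (t := u) (by simp; tauto)
  · simpa only [e1, e2, e3, hp] using
      h.hemi₅ (x := a) (y := b) (z := d) (t := w) (s := u) (by simp; tauto)

variable {v : V}

theorem KeptFlag.not_isRev_of_mem (h : HemiCoding c) (F : KeptFlag c a b d) (hv : v ∈ [a, b, d])
    (hw : (c v w).isRev) (hs : Split (c v u) (c w u)) : False := by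
  simp only [List.mem_cons, List.not_mem_nil, or_false] at hv
  rcases hv with rfl | rfl | rfl
  · exact F.not_isRev_apex h hw hs
  · exact F.not_isRev_left h hw hs
  · exact F.not_isRev_right h hw hs

theorem RevFlag.split (h : HemiCoding c) (J : RevFlag c u v w) : Split (c v u) (c w u) :=
  .inl ⟨h.full_swap J.ab, h.void_swap J.ad⟩

theorem Split.symm {t t' : PairCode} (h : Split t t') : Split t' t := by
  unfold Split at *; tauto

theorem KeptFlag.not_revFlag_apex (h : HemiCoding c) (F : KeptFlag c a b d) (J : RevFlag c a v w)
    (hv : v ∉ [a, b, d]) (hw : w ∉ [a, b, d]) : False := by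
  simp only [List.mem_cons, List.not_mem_nil, or_false, not_or] at hv hw
  have n1 := F.ne_left h
  have n2 := F.ne_right h
  have n3 := F.ne h
  have n4 := h.ne_of_isRev J.bd
  have e1 := F.ab
  have e2 := F.ad
  have e3 := J.ab
  have e4 := J.ad
  refine not_hemiTab_of_apex (c b d) (c v w) F.bd J.bd (c b v) ?_ (c d v) ?_ ?_ ?_ (c b w) ?_ ?_ ?_
    (c d w) ?_ ?_ ?_ ?_ ?_ ?_
  · simpa only [e1, e3] using h.hemi₃ (x := a) (y := b) (z := v) (by simp; tauto)
  · simpa only [e2, e3] using h.hemi₃ (x := a) (y := d) (z := v) (by simp; tauto)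
  · exact h.hemi₃ (by simp; tauto)
  · simpa only [e1, e2, e3] using h.hemi₄ (x := a) (y := b) (z := d) (t := v) (by simp; tauto)
  · simpa only [e1, e4] using h.hemi₃ (x := a) (y := b) (z := w) (by simp; tauto)
  · exact h.hemi₃ (by simp; tauto)
  · simpa only [e1, e3, e4] using h.hemi₄ (x := a) (y := b) (z := v) (t := w) (by simp; tauto)
  · simpa only [e2, e4] using h.hemi₃ (x := a) (y := d) (z := w) (by simp; tauto)
  · exact h.hemi₃ (by simp; tauto)
  · exact h.hemi₃ (by simp; tauto)
  · simpa only [e2, e3, e4] using h.hemi₄ (x := a) (y := d) (z := v) (t := w) (by simp; tauto)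
  · simpa only [e1, e2, e4] using h.hemi₄ (x := a) (y := b) (z := d) (t := w) (by simp; tauto)
  · simpa only [e1, e2, e3, e4] using
      h.hemi₅ (x := a) (y := b) (z := d) (t := v) (s := w) (by simp; tauto)

/-- A kept flag and a reversed flag have no common vertex. -/
theorem KeptFlag.disjoint_revFlag (h : HemiCoding c) (F : KeptFlag c a b d) (J : RevFlag c u v w)
    {x : V} (hx : x ∈ [a, b, d]) (hy : x ∈ [u, v, w]) : False := by
  have hs := J.split h
  have hv : v ∉ [a, b, d] := fun hv => F.not_isRev_of_mem h hv J.bd hs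
  have hw : w ∉ [a, b, d] := fun hw => F.not_isRev_of_mem h hw (h.isRev_swap J.bd) hs.symm
  have hu : u ∈ [a, b, d] := by
    simp only [List.mem_cons, List.not_mem_nil, or_false] at hy
    rcases hy with rfl | rfl | rfl
    exacts [hx, absurd hx hv, absurd hx hw]
  have hs' := F.flip.split h.flip
  have hb : b ≠ u := fun e => J.flip.not_isRev_of_mem h.flip (by simp [e]) F.flip.bd hs'
  have hd : d ≠ u := fun e =>
    J.flip.not_isRev_of_mem h.flip (by simp [e]) (h.flip.isRev_swap F.flip.bd) hs'.symm
  simp only [List.mem_cons, List.not_mem_nil, or_false] at hu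
  rcases hu with rfl | rfl | rfl
  · exact F.not_revFlag_apex h J hv hw
  · exact hb rfl
  · exact hd rfl

theorem KeptFlag.replace (h : HemiCoding c) (F : KeptFlag c a b d) {x y : V} (hx : x ∈ [a, b, d])
    (hxy : (c x y).isRev) : ∃ a' b' d', KeptFlag c a' b' d' ∧ y ∈ [a', b', d'] := by
  simp only [List.mem_cons, List.not_mem_nil, or_false] at hx
  rcases hx with rfl | rfl | rfl
  · exact ⟨_, _, _, F.replace_apex h hxy, by simp⟩
  · exact ⟨_, _, _, (F.replace_left h hxy).1, by simp⟩
  · exact ⟨_, _, _, (F.replace_right h hxy).1, by simp⟩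

theorem KeptFlag.isRev_eq_false (h : HemiCoding c) (F : KeptFlag c a b d) (J : RevFlag c u v w)
    {x y : V} (hx : x ∈ [a, b, d]) (hy : y ∈ [u, v, w]) : ¬ (c x y).isRev := by
  intro hxy
  obtain ⟨a', b', d', F', hy'⟩ := F.replace h hx hxy
  exact F'.disjoint_revFlag h J hy' hy

theorem PairCode.neutral_iff (p : PairCode) : p.Neutral ↔ ¬ p.isRev ∧ ¬ p.isKept := by
  cases p <;> simp [PairCode.Neutral, isRev, isKept]

theorem KeptFlag.neutral (h : HemiCoding c) (F : KeptFlag c a b d) (J : RevFlag c u v w)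
    {x y : V} (hx : x ∈ [a, b, d]) (hy : y ∈ [u, v, w]) : (c x y).Neutral := by
  rw [PairCode.neutral_iff]
  refine ⟨F.isRev_eq_false h J hx hy, fun hk => ?_⟩
  refine J.flip.isRev_eq_false h.flip F.flip hy hx ?_
  have := h.isKept_swap hk
  revert this
  cases c y x <;> simp [isRev, isKept, PairCode.flip]

theorem KeptFlag.not_split (h : HemiCoding c) (F : KeptFlag c a b d)
    {x v w : V} (hvw : (c v w).isRev) (hx : x ∈ [a, b, d]) : ¬ Split (c x v) (c x w) := by
  rintro (⟨h1, h2⟩ | ⟨h1, h2⟩)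
  · exact F.disjoint_revFlag h ⟨h1, h2, hvw⟩ hx (by simp)
  · exact F.disjoint_revFlag h ⟨h2, h1, h.isRev_swap hvw⟩ hx (by simp)

theorem PairCode.Neutral.eq_of_not_split {t t' : PairCode} (h : t.Neutral) (h' : t'.Neutral)
    (hs : ¬ Split t t') : t = t' := by
  unfold PairCode.Neutral Split at *
  rcases h with rfl | rfl <;> rcases h' with rfl | rfl <;> simp_all

theorem KeptFlag.not_revFlag (h : HemiCoding c) (F : KeptFlag c a b d) :
    ¬ RevFlag c u v w := by
  intro J
  have hdis := fun x => F.disjoint_revFlag h J (x := x)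
  have N : ∀ x ∈ [a, b, d], ∀ y ∈ [u, v, w], (c x y).Neutral := fun x hx y hy =>
    F.neutral h J hx hy
  have E : ∀ x ∈ [a, b, d], c x v = c x w := fun x hx =>
    (N x hx v (by simp)).eq_of_not_split (N x hx w (by simp)) (F.not_split h J.bd hx)
  have E' : ∀ y ∈ [u, v, w], c b y = c d y := by
    intro y hy
    refine (N b (by simp) y hy).eq_of_not_split (N d (by simp) y hy) ?_
    rintro (⟨h1, h2⟩ | ⟨h1, h2⟩)
    · exact KeptFlag.disjoint_revFlag h ⟨h.full_swap h1, h.void_swap h2, F.bd⟩ J (x := y)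
        (by simp) hy
    · exact KeptFlag.disjoint_revFlag h ⟨h.full_swap h2, h.void_swap h1, h.isKept_swap F.bd⟩ J
        (x := y) (by simp) hy
  have n1 := F.ne_left h
  have n2 := F.ne_right h
  have n3 := F.ne h
  have n4 := J.flip.ne_left h.flip
  have n5 := J.flip.ne_right h.flip
  have n6 := J.flip.ne h.flip
  have e1 := F.ab
  have e2 := F.ad
  have e3 := J.ab
  have e4 := J.ad
  have nd : [a, b, d, u, v, w].Nodup := by
    have : [a, b, d, u, v, w] = [a, b, d] ++ [u, v, w] := rfl
    rw [this, List.nodup_append]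
    refine ⟨by simp; tauto, by simp; tauto, fun x hx y hy e => hdis x hx (e ▸ hy)⟩
  refine not_hemiTab_of_flags (c b d) (c v w) F.bd J.bd (c a u) (N _ (by simp) _ (by simp)) (c b u)
    (N _ (by simp) _ (by simp)) (c a v) (N _ (by simp) _ (by simp)) (c b v)
    (N _ (by simp) _ (by simp)) ?_
  have H := h.hemi₆ nd
  rwa [e1, e2, e3, e4, ← E a (by simp), ← E b (by simp), ← E d (by simp), ← E' u (by simp),
    ← E' v (by simp)] at H

end

section

variable {X L : List V} {f : V → V} {p q : V}

theorem isoMatch_eq_iff : ∀ p q : PairCode, isoMatch p q ∨ dualMatch p q →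
    (p = void ↔ q = void) ∧ (p = full ↔ q = full) := by
  decide +kernel

theorem apply_eq_self_of_forall_ne {k : PairCode} {z : V} (hf : Set.BijOn f {x | x ∈ L} {x | x ∈ L})
    (hk : ∀ x ∈ L, ∀ y ∈ L, c x y = k ↔ c (f x) (f y) = k) (hz : z ∈ L)
    (h1 : ∀ y ∈ L, y ≠ z → c z y ≠ k) (h2 : ∀ z' ∈ L, z' ≠ z → ∃ y ∈ L, y ≠ z' ∧ c z' y = k) :
    f z = z := by
  by_contra hne
  obtain ⟨y, hy, hyz, hyk⟩ := h2 _ (hf.mapsTo hz) hne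
  obtain ⟨w, hw, rfl⟩ := hf.surjOn hy
  exact h1 w hw (fun e => hyz (by rw [e])) ((hk z hz w hw).2 hyk)

theorem apply_eq_self_of_unique {k : PairCode} {z w : V}
    (hf : Set.BijOn f {x | x ∈ L} {x | x ∈ L})
    (hk : ∀ x ∈ L, ∀ y ∈ L, c x y = k ↔ c (f x) (f y) = k) (hz : z ∈ L) (hw : w ∈ L)
    (hzf : f z = z) (hne : w ≠ z) (h1 : c z w = k) (h2 : ∀ y ∈ L, y ≠ z → c z y = k → y = w) :
    f w = w := by
  refine h2 _ (hf.mapsTo hw) (fun e => hne (hf.injOn hw hz (by rw [e, hzf]))) ?_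
  have := (hk z hz w hw).1 h1
  rwa [hzf] at this

theorem bijOn_tail (hf : Set.BijOn f {x | x ∈ p :: q :: X} {x | x ∈ p :: q :: X}) (hp : p ∉ X)
    (hq : q ∉ X) (hfp : f p = p) (hfq : f q = q) : Set.BijOn f {x | x ∈ X} {x | x ∈ X} := by
  have hp' : p ∈ {x | x ∈ p :: q :: X} := by simp
  have hq' : q ∈ {x | x ∈ p :: q :: X} := by simp
  have hX : ∀ x ∈ X, x ∈ {x | x ∈ p :: q :: X} := by
    intro x hx; simp [hx]
  refine ⟨fun x hx => ?_, fun x hx y hy e => hf.injOn (hX x hx) (hX y hy) e, fun x hx => ?_⟩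
  · have h1 := hf.mapsTo (hX x hx)
    simp only [Set.mem_ofPred_eq, List.mem_cons] at h1
    rcases h1 with h1 | h1 | h1
    · have := hf.injOn (hX x hx) hp' (by rw [h1, hfp])
      exact absurd (this ▸ hx) hp
    · have := hf.injOn (hX x hx) hq' (by rw [h1, hfq])
      exact absurd (this ▸ hx) hq
    · exact h1
  · obtain ⟨y, hy, rfl⟩ := hf.surjOn (hX x hx)
    simp only [Set.mem_ofPred_eq, List.mem_cons] at hy hx
    rcases hy with rfl | rfl | hy
    · exact absurd (hfp ▸ hx) hp
    · exact absurd (hfq ▸ hx) hq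
    · exact ⟨y, hy, rfl⟩

theorem HemiCoding.exists_bijOn (h : HemiCoding c) (hL : L.Nodup) (hl : L.length ≤ 6) :
    ∃ f : V → V, Set.BijOn f {x | x ∈ L} {x | x ∈ L} ∧
      ((∀ x ∈ L, ∀ y ∈ L, isoMatch (c x y) (c (f x) (f y)) = true) ∨
        (∀ x ∈ L, ∀ y ∈ L, dualMatch (c x y) (c (f x) (f y)) = true)) ∧
      (∀ x ∈ L, ∀ y ∈ L, c x y = void ↔ c (f x) (f y) = void) ∧
      (∀ x ∈ L, ∀ y ∈ L, c x y = full ↔ c (f x) (f y) = full) := by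
  obtain ⟨f, hf, h1⟩ := h.hemi L hL hl
  have key : ∀ x ∈ L, ∀ y ∈ L, isoMatch (c x y) (c (f x) (f y)) = true ∨
      dualMatch (c x y) (c (f x) (f y)) = true := fun x hx y hy =>
    h1.imp (fun h => h x hx y hy) (fun h => h x hx y hy)
  exact ⟨f, hf, h1, fun x hx y hy => (isoMatch_eq_iff _ _ (key x hx y hy)).1,
    fun x hx y hy => (isoMatch_eq_iff _ _ (key x hx y hy)).2⟩

theorem dualMatch_self_of_isKept : ∀ k : PairCode, k.isKept → dualMatch k k = false := by
  decide +kernel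

theorem PairCode.ne_of_isKept {k : PairCode} (h : k.isKept) : k ≠ full ∧ k ≠ void := by
  revert h; cases k <;> simp [isKept]

theorem isoMatch_of_keptFlag_apex (h : HemiCoding c) {b d : V} (hX : X.Nodup)
    (hl : X.length ≤ 4) (F : ∀ x ∈ X, KeptFlag c x b d) :
    ∃ f : V → V, Set.BijOn f {x | x ∈ X} {x | x ∈ X} ∧
      ∀ x ∈ X, ∀ y ∈ X, isoMatch (c x y) (c (f x) (f y)) = true := by
  by_cases hX0 : X = []
  · subst hX0
    exact ⟨id, by simp, by simp⟩
  obtain ⟨a, ha⟩ := List.exists_mem_of_ne_nil X hX0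
  have hbX : b ∉ X := fun hb => (F b hb).ne_left h rfl
  have hdX : d ∉ X := fun hd => (F d hd).ne_right h rfl
  have hbd := (F a ha).ne h
  obtain ⟨f, hf, h1, hv, hfu⟩ := h.exists_bijOn (L := b :: d :: X) (by simp [*])
    (by simp; omega)
  have hfb : f b = b := by
    refine apply_eq_self_of_forall_ne hf hv (by simp) ?_ ?_
    · intro y hy hyb
      simp only [List.mem_cons] at hy
      rcases hy with rfl | rfl | hy
      · exact absurd rfl hyb
      · exact (ne_of_isKept (F a ha).bd).2
      · simp [h.full_swap (F y hy).ab]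
    · intro z hz hzb
      simp only [List.mem_cons] at hz
      rcases hz with rfl | rfl | hz
      · exact absurd rfl hzb
      · exact ⟨a, by simp [ha], (F a ha).ne_right h, h.void_swap (F a ha).ad⟩
      · exact ⟨d, by simp, ((F z hz).ne_right h).symm, (F z hz).ad⟩
  have hfd : f d = d := by
    refine apply_eq_self_of_forall_ne hf hfu (by simp) ?_ ?_
    · intro y hy hyb
      simp only [List.mem_cons] at hy
      rcases hy with rfl | rfl | hy
      · exact (ne_of_isKept (h.isKept_swap (F a ha).bd)).1
      · exact absurd rfl hyb
      · simp [h.void_swap (F y hy).ad]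
    · intro z hz hzb
      simp only [List.mem_cons] at hz
      rcases hz with rfl | rfl | hz
      · exact ⟨a, by simp [ha], (F a ha).ne_left h, h.full_swap (F a ha).ab⟩
      · exact absurd rfl hzb
      · exact ⟨b, by simp, ((F z hz).ne_left h).symm, (F z hz).ab⟩
  refine ⟨f, bijOn_tail hf hbX hdX hfb hfd, fun x hx y hy => ?_⟩
  rcases h1 with h1 | h1
  · exact h1 x (by simp [hx]) y (by simp [hy])
  · have := h1 b (by simp) d (by simp)
    rw [hfb, hfd, dualMatch_self_of_isKept _ (F a ha).bd] at this
    simp at this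

theorem isoMatch_of_keptFlag_left (h : HemiCoding c) {a d : V} {k : PairCode} (hX : X.Nodup)
    (hl : X.length ≤ 4) (F : ∀ x ∈ X, KeptFlag c a x d ∧ c x d = k) :
    ∃ f : V → V, Set.BijOn f {x | x ∈ X} {x | x ∈ X} ∧
      ∀ x ∈ X, ∀ y ∈ X, isoMatch (c x y) (c (f x) (f y)) = true := by
  by_cases hX0 : X = []
  · subst hX0
    exact ⟨id, by simp, by simp⟩
  obtain ⟨b, hb⟩ := List.exists_mem_of_ne_nil X hX0
  have haX : a ∉ X := fun ha => (F a ha).1.ne_left h rfl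
  have hdX : d ∉ X := fun hd => (F d hd).1.ne h rfl
  have had := (F b hb).1.ne_right h
  obtain ⟨f, hf, h1, hv, hfu⟩ := h.exists_bijOn (L := a :: d :: X) (by simp [*])
    (by simp; omega)
  have hfd : f d = d := by
    refine apply_eq_self_of_forall_ne hf hfu (by simp) ?_ ?_
    · intro y hy hyb
      simp only [List.mem_cons] at hy
      rcases hy with rfl | rfl | hy
      · simp [h.void_swap (F b hb).1.ad]
      · exact absurd rfl hyb
      · exact (ne_of_isKept (h.isKept_swap (F y hy).1.bd)).1
    · intro z hz hzb
      simp only [List.mem_cons] at hz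
      rcases hz with rfl | rfl | hz
      · exact ⟨b, by simp [hb], ((F b hb).1.ne_left h).symm, (F b hb).1.ab⟩
      · exact absurd rfl hzb
      · exact ⟨a, by simp, (F z hz).1.ne_left h, h.full_swap (F z hz).1.ab⟩
  have hfa : f a = a := by
    refine apply_eq_self_of_unique hf hv (z := d) (by simp) (by simp) hfd had
      (h.void_swap (F b hb).1.ad) ?_
    intro y hy hyb hyv
    simp only [List.mem_cons] at hy
    rcases hy with rfl | rfl | hy
    · rfl
    · exact absurd rfl hyb
    · exact absurd hyv (ne_of_isKept (h.isKept_swap (F y hy).1.bd)).2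
  have hbij := bijOn_tail hf haX hdX hfa hfd
  refine ⟨f, hbij, fun x hx y hy => ?_⟩
  rcases h1 with h1 | h1
  · exact h1 x (by simp [hx]) y (by simp [hy])
  · have := h1 x (by simp [hx]) d (by simp)
    rw [hfd, (F x hx).2, (F _ (hbij.mapsTo hx)).2,
      dualMatch_self_of_isKept _ ((F x hx).2 ▸ (F x hx).1.bd)] at this
    simp at this

theorem isoMatch_of_keptFlag_right (h : HemiCoding c) {a b : V} {k : PairCode} (hX : X.Nodup)
    (hl : X.length ≤ 4) (F : ∀ x ∈ X, KeptFlag c a b x ∧ c b x = k) :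
    ∃ f : V → V, Set.BijOn f {x | x ∈ X} {x | x ∈ X} ∧
      ∀ x ∈ X, ∀ y ∈ X, isoMatch (c x y) (c (f x) (f y)) = true := by
  by_cases hX0 : X = []
  · subst hX0
    exact ⟨id, by simp, by simp⟩
  obtain ⟨d, hd⟩ := List.exists_mem_of_ne_nil X hX0
  have haX : a ∉ X := fun ha => (F a ha).1.ne_right h rfl
  have hbX : b ∉ X := fun hb => (F b hb).1.ne h rfl
  have hab := (F d hd).1.ne_left h
  obtain ⟨f, hf, h1, hv, hfu⟩ := h.exists_bijOn (L := a :: b :: X) (by simp [*])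
    (by simp; omega)
  have hfb : f b = b := by
    refine apply_eq_self_of_forall_ne hf hv (by simp) ?_ ?_
    · intro y hy hyb
      simp only [List.mem_cons] at hy
      rcases hy with rfl | rfl | hy
      · simp [h.full_swap (F d hd).1.ab]
      · exact absurd rfl hyb
      · exact (ne_of_isKept (F y hy).1.bd).2
    · intro z hz hzb
      simp only [List.mem_cons] at hz
      rcases hz with rfl | rfl | hz
      · exact ⟨d, by simp [hd], ((F d hd).1.ne_right h).symm, (F d hd).1.ad⟩
      · exact absurd rfl hzb
      · exact ⟨a, by simp, (F z hz).1.ne_right h, h.void_swap (F z hz).1.ad⟩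
  have hfa : f a = a := by
    refine apply_eq_self_of_unique hf hfu (z := b) (by simp) (by simp) hfb hab
      (h.full_swap (F d hd).1.ab) ?_
    intro y hy hyb hyv
    simp only [List.mem_cons] at hy
    rcases hy with rfl | rfl | hy
    · rfl
    · exact absurd rfl hyb
    · exact absurd hyv (ne_of_isKept (F y hy).1.bd).1
  have hbij := bijOn_tail hf haX hbX hfa hfb
  refine ⟨f, hbij, fun x hx y hy => ?_⟩
  rcases h1 with h1 | h1
  · exact h1 x (by simp [hx]) y (by simp [hy])
  · have := h1 b (by simp) x (by simp [hx])
    rw [hfb, (F x hx).2, (F _ (hbij.mapsTo hx)).2,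
      dualMatch_self_of_isKept _ ((F x hx).2 ▸ (F x hx).1.bd)] at this
    simp at this

theorem KeptFlag.isoMatch_of_revRel (h : HemiCoding c) {a b d v : V} (F : KeptFlag c a b d)
    (hv : v ∈ [a, b, d]) (hX : X.Nodup) (hl : X.length ≤ 4) (hR : ∀ x ∈ X, RevRel c v x) :
    ∃ f : V → V, Set.BijOn f {x | x ∈ X} {x | x ∈ X} ∧
      ∀ x ∈ X, ∀ y ∈ X, isoMatch (c x y) (c (f x) (f y)) = true := by
  simp only [List.mem_cons, List.not_mem_nil, or_false] at hv
  rcases hv with rfl | rfl | rfl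
  · exact isoMatch_of_keptFlag_apex h hX hl fun x hx => F.apex_of_revRel h (hR x hx)
  · exact isoMatch_of_keptFlag_left h hX hl fun x hx => F.left_of_revRel h (hR x hx)
  · exact isoMatch_of_keptFlag_right h hX hl fun x hx => F.right_of_revRel h (hR x hx)

end

theorem HemiCoding.search₃ (h : HemiCoding c) {x y z : V} (hL : [x, y, z].Nodup) {f : V → V}
    (hf : Set.BijOn f {t | t ∈ [x, y, z]} {t | t ∈ [x, y, z]})
    (hm : ∀ s ∈ [x, y, z], ∀ t ∈ [x, y, z], isoMatch (c s t) (c (f s) (f t)) = true) :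
    search 3 (tab [c x y, c x z, c y z]) isoMatch 3 [] = true := by
  refine search_of_bijOn h hL (u := [c x y, c x z, c y z]) ?_ hf hm
  intro j hj i hi
  simp only [List.length_cons, List.length_nil] at hj
  interval_cases j <;> interval_cases i <;> rfl

section

variable {a b d x y z : V}

theorem RevPeak.nodup (h : HemiCoding c) (J : RevPeak c x y z) : [x, y, z].Nodup := by
  have n1 := h.ne_of_isRev J.xy
  have n2 := h.ne_of_isRev (J.eq ▸ J.xy)
  have n3 := J.ne
  simp; tauto

theorem RevPeak.revRel (h : HemiCoding c) (J : RevPeak c x y z) {s t : V} (hs : s ∈ [x, y, z])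
    (ht : t ∈ [x, y, z]) : RevRel c s t := by
  have h1 := J.xy
  have h2 : (c x z).isRev := J.eq ▸ J.xy
  have A : RevRel c s x := by
    simp only [List.mem_cons, List.not_mem_nil, or_false] at hs
    rcases hs with rfl | rfl | rfl
    exacts [.refl, .single (h.isRev_swap h1), .single (h.isRev_swap h2)]
  refine A.trans ?_
  simp only [List.mem_cons, List.not_mem_nil, or_false] at ht
  rcases ht with rfl | rfl | rfl
  exacts [.refl, .single h1, .single h2]

/-- A kept flag and a reversed peak have no common vertex. -/
theorem KeptFlag.disjoint_revPeak (h : HemiCoding c) (F : KeptFlag c a b d) (J : RevPeak c x y z)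
    {v : V} (hv : v ∈ [a, b, d]) (hv' : v ∈ [x, y, z]) : False := by
  obtain ⟨f, hf, hm⟩ := F.isoMatch_of_revRel h hv (J.nodup h) (by simp)
    (fun t ht => J.revRel h hv' ht)
  have := h.search₃ (J.nodup h) hf hm
  rw [J.eq] at this
  exact not_search_of_peak _ _ J.xy J.yz this

theorem KeptFlag.not_revPeak (h : HemiCoding c) (F : KeptFlag c a b d) : ¬ RevPeak c x y z := by
  intro J
  have hdis := fun v => F.disjoint_revPeak h J (v := v)
  have N : ∀ v ∈ [a, b, d], ∀ t ∈ [x, y, z], ¬ (c v t).isRev := by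
    intro v hv t ht hr
    obtain ⟨a', b', d', F', hy'⟩ := F.replace h hv hr
    exact F'.disjoint_revPeak h J hy' ht
  have nJ := J.nodup h
  have h2 : (c x z).isRev := J.eq ▸ J.xy
  have E : ∀ v ∈ [a, b, d], c v x = c v y ∧ c v x = c v z := by
    intro v hv
    have hvJ : v ∉ [x, y, z] := hdis v hv
    simp only [List.nodup_cons, List.mem_cons, List.not_mem_nil, or_false, not_or] at hvJ nJ
    have key : ∀ t ∈ [x, y, z], (c x t).isRev → v ≠ t → c v x = c v t := by
      intro t ht hr hvt
      refine eq_of_isRev _ hr _ (N v hv x (by simp)) _ (N v hv t ht)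
        (fun hs => ?_) (h.hemi₃ ?_)
      · rcases hs with ⟨h1, h2⟩ | ⟨h1, h2⟩
        · exact F.not_revFlag h ⟨h1, h2, hr⟩
        · exact F.not_revFlag h ⟨h2, h1, h.isRev_swap hr⟩
      · have := h.ne_of_isRev hr
        simp; tauto
    exact ⟨key y (by simp) J.xy (by tauto), key z (by simp) h2 (by tauto)⟩
  have n1 := F.ne_left h
  have n2 := F.ne_right h
  have n3 := F.ne h
  have nd : [a, b, d, x, y, z].Nodup := by
    have : [a, b, d, x, y, z] = [a, b, d] ++ [x, y, z] := rfl
    rw [this, List.nodup_append]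
    refine ⟨by simp; tauto, nJ, fun x hx y hy e => hdis x hx (e ▸ hy)⟩
  refine not_hemiTab_of_flag_of_peak (c b d) (c x y) (c y z) F.bd J.xy J.yz
    (c a x) (N _ (by simp) _ (by simp)) (c b x) (N _ (by simp) _ (by simp))
    (c d x) (N _ (by simp) _ (by simp)) ?_
  have H := h.hemi₆ nd
  rwa [F.ab, F.ad, J.eq, ← (E a (by simp)).1, ← (E a (by simp)).2, ← (E b (by simp)).1,
    ← (E b (by simp)).2, ← (E d (by simp)).1, ← (E d (by simp)).2] at H

end

section

variable {G G' : Dgraph V}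

theorem Iso.exists_bijOn {X : Set V} (h : Iso (G.ind X) (G'.ind X)) :
    ∃ f : V → V, Set.BijOn f X X ∧ ∀ x ∈ X, ∀ y ∈ X, G.Arc x y ↔ G'.Arc (f x) (f y) := by
  classical
  obtain ⟨e, he⟩ := h
  have hf : ∀ x (hx : x ∈ X), (if hx : x ∈ X then (e ⟨x, hx⟩ : V) else x) = e ⟨x, hx⟩ :=
    fun x hx => dif_pos hx
  refine ⟨fun x => if hx : x ∈ X then e ⟨x, hx⟩ else x, ⟨fun x hx => ?_, fun x hx y hy hxy => ?_,
    fun y hy => ?_⟩, fun x hx y hy => ?_⟩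
  · simp only [hf x hx]
    exact (e ⟨x, hx⟩).2
  · simp only [hf x hx, hf y hy] at hxy
    exact congrArg Subtype.val (e.injective (Subtype.ext hxy))
  · refine ⟨e.symm ⟨y, hy⟩, (e.symm ⟨y, hy⟩).2, ?_⟩
    beta_reduce
    rw [hf _ (e.symm ⟨y, hy⟩).2, Subtype.coe_eta, Equiv.apply_symm_apply]
  · simp only [hf x hx, hf y hy]
    exact he ⟨x, hx⟩ ⟨y, hy⟩

theorem Iso.of_bijOn {X : Set V} {f : V → V} (hf : Set.BijOn f X X)
    (h : ∀ x ∈ X, ∀ y ∈ X, G.Arc x y ↔ G'.Arc (f x) (f y)) : Iso (G.ind X) (G'.ind X) :=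
  ⟨hf.equiv, fun x y => h x x.2 y y.2⟩

theorem Iso.symm {W : Type v} {H : Dgraph V} {H' : Dgraph W} (h : Iso H H') : Iso H' H := by
  obtain ⟨e, he⟩ := h
  exact ⟨e.symm, fun x y => by simp [he]⟩

theorem Hemi.exists_bijOn {X : Set V} (h : Hemi (G.ind X) (G'.ind X)) :
    ∃ f : V → V, Set.BijOn f X X ∧ ((∀ x ∈ X, ∀ y ∈ X, G.Arc x y ↔ G'.Arc (f x) (f y)) ∨
      (∀ x ∈ X, ∀ y ∈ X, G.Arc y x ↔ G'.Arc (f x) (f y))) := by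
  rcases h with h | h
  · obtain ⟨f, hf, h⟩ := h.exists_bijOn
    exact ⟨f, hf, .inl h⟩
  · obtain ⟨f, hf, h⟩ := Iso.exists_bijOn (G := G.dual) h
    exact ⟨f, hf, .inr h⟩

open Classical in
/-- The code of a pair of vertices for two `{2}`-hemimorphic digraphs. -/
noncomputable def code (G G' : Dgraph V) (x y : V) : PairCode :=
  if G.Arc x y then
    if G.Arc y x then full else if G'.Arc x y then fwdKept else fwdRev
  else if G.Arc y x then
    if G'.Arc y x then bwdKept else bwdRev
  else void

theorem code_swap (x y : V) : code G G' y x = (code G G' x y).swap := by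
  unfold code
  split_ifs <;> rfl

theorem fst_code {x y : V} : (code G G' x y).fst = true ↔ G.Arc x y := by
  unfold code
  split_ifs <;> simp_all [PairCode.fst]

theorem KHemi.arc_pair (h : KHemi 2 G G') (x y : V) :
    ((G.Arc x y ↔ G'.Arc x y) ∧ (G.Arc y x ↔ G'.Arc y x)) ∨
      ((G.Arc x y ↔ G'.Arc y x) ∧ (G.Arc y x ↔ G'.Arc x y)) := by
  rcases eq_or_ne x y with rfl | hxy
  · simp [G.irrefl, G'.irrefl]
  obtain ⟨f, hf, h1⟩ := (h {x, y} (Set.toFinite _) (Set.ncard_pair hxy)).exists_bijOn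
  have hx : f x = x ∨ f x = y := by simpa using hf.mapsTo (show x ∈ ({x, y} : Set V) by simp)
  have hy : f y = x ∨ f y = y := by simpa using hf.mapsTo (show y ∈ ({x, y} : Set V) by simp)
  have hne : f x ≠ f y := fun e => hxy (hf.injOn (by simp) (by simp) e)
  rcases h1 with h1 | h1 <;>
  · have h2 := h1 x (by simp) y (by simp)
    have h3 := h1 y (by simp) x (by simp)
    rcases hx with hx | hx <;> rcases hy with hy | hy <;> rw [hx, hy] at h2 h3 hne <;> tauto

theorem snd_code (h : KHemi 2 G G') {x y : V} : (code G G' x y).snd = true ↔ G'.Arc x y := by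
  have := h.arc_pair x y
  unfold code
  split_ifs <;> simp [PairCode.snd] <;> tauto

theorem isMatch_code (h : KHemi 2 G G') {x y s t : V} :
    isoMatch (code G G' x y) (code G G' s t) = true ↔
      (G.Arc x y ↔ G'.Arc s t) ∧ (G.Arc y x ↔ G'.Arc t s) := by
  rw [isoMatch, Bool.and_eq_true, beq_iff_eq, beq_iff_eq, ← code_swap, ← code_swap,
    Bool.eq_iff_iff (b := snd _), Bool.eq_iff_iff (b := snd _), fst_code, fst_code, snd_code h,
    snd_code h]

theorem LeHemi.hemiCoding (h : LeHemi 6 G G') : HemiCoding (code G G') where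
  self x := by simp [code, G.irrefl]
  swap := code_swap
  hemi L hL hl := by
    classical
    have h2 := h 2 (by simp) (by simp)
    by_cases hL0 : L = []
    · subst hL0
      exact ⟨id, by simp, by simp⟩
    have hc : {x | x ∈ L}.ncard = L.length := by
      rw [← List.toFinset_card_of_nodup hL, ← Set.ncard_coe_finset]
      simp
    obtain ⟨f, hf, h1⟩ := (h L.length (List.length_pos_iff.2 hL0) hl {x | x ∈ L}
      (List.finite_toSet L) hc).exists_bijOn
    refine ⟨f, hf, h1.imp (fun h1 x hx y hy => ?_) (fun h1 x hx y hy => ?_)⟩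
    · exact (isMatch_code h2).2 ⟨h1 x hx y hy, h1 y hy x hx⟩
    · rw [dualMatch, ← code_swap]
      exact (isMatch_code h2).2 ⟨h1 x hx y hy, h1 y hy x hx⟩

theorem diffStep_iff (h : KHemi 2 G G') {x y : V} :
    DiffStep G G' x y ↔ (code G G' x y).isRev = true := by
  rw [DiffStep, ← fst_code (G' := G'), ← snd_code h]
  cases code G G' x y <;> simp [PairCode.fst, PairCode.snd, isRev]

theorem diffRel_iff (h : KHemi 2 G G') {x y : V} :
    DiffRel G G' x y ↔ RevRel (code G G') x y := by
  have : DiffStep G G' = fun x y => (code G G' x y).isRev = true := by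
    ext x y
    exact diffStep_iff h
  rw [DiffRel, RevRel, Relation.reflTransGen_iff_eq_or_transGen, this, eq_comm]

theorem exists_eq_of_equiv {J : Set V} (e : J ≃ Fin 3) :
    J = {↑(e.symm 2), ↑(e.symm 1), ↑(e.symm 0)} := by
  ext x
  simp only [Set.mem_insert_iff, Set.mem_singleton_iff]
  refine ⟨fun hx => ?_, ?_⟩
  · have h3 : (x : V) = e.symm (e ⟨x, hx⟩) := by simp
    rw [h3]
    generalize e ⟨x, hx⟩ = i
    fin_cases i <;> simp
  · rintro (rfl | rfl | rfl) <;> exact Subtype.coe_prop _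

theorem IsFlag.exists_eq {J : Set V} (h : IsFlag (G.ind J)) : ∃ a b d, J = {a, b, d} ∧
    (G.Arc a b ∧ G.Arc b a) ∧ (¬ G.Arc a d ∧ ¬ G.Arc d a) ∧ G.Dir b d := by
  rcases h with ⟨e, he⟩ | ⟨e, he⟩ <;>
  · refine ⟨_, _, _, exists_eq_of_equiv e, ?_⟩
    have he' := fun i j => he (e.symm i) (e.symm j)
    simp only [Equiv.apply_symm_apply, ind, dual, flagD, ofRel] at he'
    simp [Dir, he']

theorem IsPeak.exists_eq {J : Set V} (h : IsPeak (G.ind J)) : ∃ x y z, J = {x, y, z} ∧ y ≠ z ∧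
    G.Dir x y ∧ (G.Arc x y ↔ G.Arc x z) ∧ (G.Arc y x ↔ G.Arc z x) ∧ ¬ G.Dir y z := by
  rcases h with (⟨e, he⟩ | ⟨e, he⟩) | (⟨e, he⟩ | ⟨e, he⟩) <;>
  · refine ⟨e.symm 0, e.symm 1, e.symm 2, ?_, ?_, ?_⟩
    · refine (exists_eq_of_equiv e).trans ?_
      ext x
      simp only [Set.mem_insert_iff, Set.mem_singleton_iff]
      tauto
    · rw [Ne, Subtype.val_inj, e.symm.injective.eq_iff]
      decide
    · have he' := fun i j => he (e.symm i) (e.symm j)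
      simp only [Equiv.apply_symm_apply, ind, dual, peakD1, peakD2, ofRel] at he'
      simp [Dir, he']

theorem code_eq_full {x y : V} (h : G.Arc x y ∧ G.Arc y x) : code G G' x y = full := by
  simp [code, h]

theorem code_eq_void {x y : V} (h : ¬ G.Arc x y ∧ ¬ G.Arc y x) : code G G' x y = void := by
  simp [code, h]

theorem not_dir_iff {x y : V} : ¬ G.Dir x y ↔ (code G G' x y).Neutral := by
  unfold Dir code
  split_ifs <;> simp_all [PairCode.Neutral]

theorem isKept_or_isRev {x y : V} (h : G.Dir x y) :
    (code G G' x y).isKept ∨ (code G G' x y).isRev := by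
  by_contra h1
  refine not_dir_iff.2 ((code G G' x y).neutral_iff.2 ?_) h
  tauto

theorem arc_iff_of_not_isRev (h : KHemi 2 G G') {x y : V} (hr : ¬ (code G G' x y).isRev) :
    G.Arc x y ↔ G'.Arc x y := by
  rw [← fst_code (G' := G'), ← snd_code h]
  revert hr
  cases code G G' x y <;> simp [PairCode.fst, PairCode.snd, isRev]

theorem IsFlag.keptFlag_or_revFlag {J : Set V} (h : IsFlag (G.ind J)) : ∃ a b d, J = {a, b, d} ∧
    (KeptFlag (code G G') a b d ∨ RevFlag (code G G') a b d) := by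
  obtain ⟨a, b, d, rfl, h1, h2, h3⟩ := h.exists_eq
  exact ⟨a, b, d, rfl, (isKept_or_isRev h3).imp
    (fun h3 => ⟨code_eq_full h1, code_eq_void h2, h3⟩)
    (fun h3 => ⟨code_eq_full h1, code_eq_void h2, h3⟩)⟩

theorem Iso.search₃ (h : LeHemi 6 G G') {x y z : V} (hL : [x, y, z].Nodup)
    (hi : Iso (G.ind {x, y, z}) (G'.ind {x, y, z})) :
    search 3 (tab [code G G' x y, code G G' x z, code G G' y z]) isoMatch 3 [] = true := by
  have hs : ({x, y, z} : Set V) = {t | t ∈ [x, y, z]} := by ext; simp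
  rw [hs] at hi
  obtain ⟨f, hf, h1⟩ := hi.exists_bijOn
  exact h.hemiCoding.search₃ hL hf fun s hs t ht =>
    (isMatch_code (h 2 (by simp) (by simp))).2 ⟨h1 s hs t ht, h1 t ht s hs⟩

theorem eq_of_search_of_peak : ∀ p q t : PairCode, ¬ p.Neutral → p.fst = q.fst →
    p.swap.fst = q.swap.fst → t.Neutral → search 3 (tab [p, q, t]) isoMatch 3 [] →
    p.isKept ∧ q = p := by
  decide +kernel

/-- A flag or a peak of the first digraph which is isomorphic to its counterpart in the second
one prevents any flag from being reversed. -/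
theorem not_revFlag_of_iso (h : LeHemi 6 G G') {I : Set V}
    (hI : IsPeak (G.ind I) ∨ IsFlag (G.ind I)) (hi : Iso (G.ind I) (G'.ind I)) {u v w : V} :
    ¬ RevFlag (code G G') u v w := by
  intro J
  have hc := h.hemiCoding
  rcases hI with hI | hI
  · obtain ⟨x, y, z, rfl, hyz, h1, h2, h3, h4⟩ := hI.exists_eq
    have hne : x ≠ y := by
      rintro rfl
      simp [Dir, G.irrefl] at h1
    have hne' : x ≠ z := by
      rintro rfl
      simp only [Dir, h2, h3, G.irrefl] at h1
      tauto
    obtain ⟨h5, h6⟩ := eq_of_search_of_peak (code G G' x y) (code G G' x z) (code G G' y z)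
      (fun hn => not_dir_iff.2 hn h1)
      (by rw [Bool.eq_iff_iff, fst_code, fst_code, h2])
      (by rw [Bool.eq_iff_iff, ← code_swap, ← code_swap, fst_code, fst_code, h3])
      (not_dir_iff.1 h4) (hi.search₃ h (by simp; tauto))
    refine J.flip.not_revPeak hc.flip (x := x) (y := y) (z := z) ⟨?_, by rw [h6], hyz, ?_⟩
    · revert h5
      cases code G G' x y <;> simp [isKept, isRev, PairCode.flip]
    · rcases not_dir_iff (G' := G').1 h4 with h4 | h4 <;> simp [h4, PairCode.flip]
  · obtain ⟨a, b, d, rfl, F | F⟩ := hI.keptFlag_or_revFlag (G' := G')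
    · exact F.not_revFlag hc J
    · have n1 := F.flip.ne_left hc.flip
      have n2 := F.flip.ne_right hc.flip
      have n3 := F.flip.ne hc.flip
      have := hi.search₃ h (by simp; tauto)
      rw [F.ab, F.ad] at this
      exact not_search_of_flag _ F.bd this

theorem KeptFlag.not_isRev_of_mem_of_mem (h : HemiCoding c) {a b d x y : V}
    (F : KeptFlag c a b d) (hx : x ∈ [a, b, d]) (hy : y ∈ [a, b, d]) : ¬ (c x y).isRev := by
  have h1 := h.full_swap F.ab
  have h2 := h.void_swap F.ad
  have key : ∀ {k : PairCode}, k.isKept → ¬ k.isRev := by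
    intro k; cases k <;> simp [isKept, isRev]
  simp only [List.mem_cons, List.not_mem_nil, or_false] at hx hy
  rcases hx with rfl | rfl | rfl <;> rcases hy with rfl | rfl | rfl <;>
    first
    | exact key F.bd
    | exact key (h.isKept_swap F.bd)
    | simp [h.self, F.ab, F.ad, h1, h2, isRev]

theorem isInterval_of_forall_iff {I : Set V} (h : ∀ x ∉ I, ∃ p q : Prop, ∀ y ∈ I,
    (G.Arc x y ↔ p) ∧ (G.Arc y x ↔ q)) : G.IsInterval I := by
  intro x hx
  obtain ⟨p, q, hpq⟩ := h x hx
  by_cases hp : p <;> by_cases hq : q <;> simp only [hp, hq, iff_true, iff_false] at hpq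
  exacts [.inr (.inr (.inl hpq)), .inl hpq, .inr (.inl fun y hy => (hpq y hy).symm),
    .inr (.inr (.inr hpq))]

theorem RevRel.code_eq (h : HemiCoding c) (hF : ∀ u v w, ¬ RevFlag c u v w) {x y z : V}
    (hyz : RevRel c y z) (hx : ¬ RevRel c y x) : c x y = c x z := by
  induction hyz with
  | refl => rfl
  | @tail s t hys hst ih =>
    have hs : ¬ (c x s).isRev := fun hr => hx (hys.tail (h.isRev_swap hr))
    have ht : ¬ (c x t).isRev := fun hr => hx ((hys.tail hst).tail (h.isRev_swap hr))
    have n1 : x ≠ s := by rintro rfl; exact hx hys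
    have n2 : x ≠ t := by rintro rfl; exact hx (hys.tail hst)
    have n3 := h.ne_of_isRev hst
    refine ih.trans (eq_of_isRev _ hst _ hs _ ht ?_ (h.hemi₃ (by simp; tauto)))
    rintro (⟨h1, h2⟩ | ⟨h1, h2⟩)
    · exact hF _ _ _ ⟨h1, h2, hst⟩
    · exact hF _ _ _ ⟨h2, h1, h.isRev_swap hst⟩

theorem Iso.of_image {C : Set V} {X : Set C}
    (h : Iso (G.ind (Subtype.val '' X)) (G'.ind (Subtype.val '' X))) :
    Iso ((G.ind C).ind X) ((G'.ind C).ind X) := by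
  obtain ⟨e, he⟩ := h
  let i := Equiv.Set.image _ X Subtype.val_injective
  refine ⟨i.trans (e.trans i.symm), fun x y => ?_⟩
  have hi : ∀ t, ((i.symm t : C) : V) = t := fun t => by
    conv_rhs => rw [← i.apply_symm_apply t]
    rfl
  have := he (i x) (i y)
  simp only [ind, Equiv.trans_apply, hi] at this ⊢
  exact this

theorem leHypo_of_isoMatch (h : KHemi 2 G G') {C : Set V} {k : ℕ}
    (hC : ∀ L : List V, L.Nodup → L.length ≤ k → (∀ x ∈ L, x ∈ C) →
      ∃ f : V → V, Set.BijOn f {x | x ∈ L} {x | x ∈ L} ∧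
        ∀ x ∈ L, ∀ y ∈ L, isoMatch (code G G' x y) (code G G' (f x) (f y)) = true) :
    LeHypo k (G.ind C) (G'.ind C) := by
  intro j _ hj X hX hXj
  obtain ⟨f, hf, h1⟩ := hC (hX.toFinset.toList.map Subtype.val)
    (hX.toFinset.nodup_toList.map Subtype.val_injective)
    (by rw [List.length_map, Finset.length_toList, ← Set.ncard_eq_toFinset_card X hX]; omega)
    (by simp +contextual)
  have hs : {x | x ∈ hX.toFinset.toList.map Subtype.val} = Subtype.val '' X := by
    ext
    simp
  refine Iso.of_image (Iso.of_bijOn (hs ▸ hf) fun x hx y hy => ?_)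
  rw [← hs] at hx hy
  exact ((isMatch_code h).1 (h1 x hx y hy)).1

end

end Dgraph

/-- Corollary CP1. -/
theorem corollary_CP1 {V : Type u} (G G' : Dgraph V)
    (hhemi : Dgraph.LeHemi 6 G G') (C : Set V) (hC : Dgraph.DiffClass G G' C)
    (I₀ : Set V) (hI₀ : Dgraph.IsPeak (G.ind I₀) ∨ Dgraph.IsFlag (G.ind I₀))
    (hiso : Dgraph.Iso (G'.ind I₀) (G.ind I₀)) :
    (G.IsInterval C ∧ G'.IsInterval C ∧ ∀ X : Set C, ¬ Dgraph.IsFlag ((G.ind C).ind X)) ∧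
    (∀ J₀ : Set V, Dgraph.IsFlag (G.ind J₀) → Dgraph.Iso (G'.ind J₀) (G.ind J₀)) ∧
    (∀ J₀ : Set V, Dgraph.IsFlag (G.ind J₀) → (C ∩ J₀).Nonempty →
      Dgraph.LeHypo 4 (G.ind C) (G'.ind C)) := by
  have hc := hhemi.hemiCoding
  have h2 := hhemi 2 (by simp) (by simp)
  have hF : ∀ u v w, ¬ RevFlag (code G G') u v w := fun u v w =>
    not_revFlag_of_iso hhemi hI₀ hiso.symm
  obtain ⟨r, rfl⟩ := hC
  have hmem : ∀ x, x ∈ {y | DiffRel G G' r y} ↔ RevRel (code G G') r x := fun x => diffRel_iff h2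
  have hconst : ∀ x ∉ {y | DiffRel G G' r y}, ∀ y ∈ {y | DiffRel G G' r y},
      code G G' x y = code G G' x r := fun x hx y hy =>
    (((hmem y).1 hy).code_eq hc hF (fun h => hx ((hmem x).2 h))).symm
  have hrel : ∀ x ∈ {y | DiffRel G G' r y}, ∀ y ∈ {y | DiffRel G G' r y},
      RevRel (code G G') x y := fun x hx y hy => by
    have : Std.Symm fun s t => (code G G' s t).isRev = true := ⟨fun s t => hc.isRev_swap⟩
    have hsymm : Std.Symm (RevRel (code G G')) := Relation.ReflTransGen.stdSymm
    exact (hsymm.symm _ _ ((hmem x).1 hx)).trans ((hmem y).1 hy)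
  have hflag : ∀ J : Set V, IsFlag (G.ind J) →
      ∃ a b d, J = {a, b, d} ∧ KeptFlag (code G G') a b d := by
    intro J hJ
    obtain ⟨a, b, d, hJ, F | F⟩ := hJ.keptFlag_or_revFlag (G' := G')
    · exact ⟨a, b, d, hJ, F⟩
    · exact absurd F (hF _ _ _)
  refine ⟨⟨?_, ?_, ?_⟩, ?_, ?_⟩
  · refine isInterval_of_forall_iff fun x hx =>
      ⟨(code G G' x r).fst, (code G G' x r).swap.fst, fun y hy => ?_⟩
    rw [← hconst x hx y hy, ← code_swap, fst_code, fst_code]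
    simp
  · refine isInterval_of_forall_iff fun x hx =>
      ⟨(code G G' x r).snd, (code G G' x r).swap.snd, fun y hy => ?_⟩
    rw [← hconst x hx y hy, ← code_swap, snd_code h2, snd_code h2]
    simp
  · intro X hX
    obtain ⟨a, b, d, -, hab, had, hbd⟩ := hX.exists_eq
    rcases isKept_or_isRev (G' := G') (x := (b : V)) (y := d) hbd with hk | hk
    · have F : KeptFlag (code G G') a b d := ⟨code_eq_full hab, code_eq_void had, hk⟩
      exact (F.apex_of_revRel hc (hrel a a.2 b b.2)).ne_left hc rfl
    · exact hF a b d ⟨code_eq_full hab, code_eq_void had, hk⟩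
  · intro J hJ
    obtain ⟨a, b, d, rfl, F⟩ := hflag J hJ
    refine Iso.symm (Iso.of_bijOn (Set.bijOn_id _) fun x hx y hy =>
      arc_iff_of_not_isRev h2 (F.not_isRev_of_mem_of_mem hc ?_ ?_)) <;> simpa
  · rintro J hJ ⟨v, hv, hvJ⟩
    obtain ⟨a, b, d, rfl, F⟩ := hflag J hJ
    exact leHypo_of_isoMatch h2 fun L hL hl hLC =>
      F.isoMatch_of_revRel hc (by simpa using hvJ) hL hl fun x hx => hrel v hv x (hLC x hx)
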